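/- arXiv:2111.10881 — 2 statements merged into one kernel-verified Lean document; each statement's English description precedes it below -/
import Mathlib

section
/- Let (P_I, P_II, Δ, c) be a pushdown parity game system over a finite alphabet 𝔸, inducing the pushdown parity game graph H, and let v₀ be a vertex of H. If Player II has a winning strategy from v₀ in the parity game over H, then there is a regular function f : 𝔸* → 𝕀₂ that determines a memoryless winning strategy for Player II from v₀ in the parity game over H. -/
/-- The maximal color occurring infinitely often in the sequence `s` exists and is even. -/
def MaxInfEven (s : ℕ → ℕ) : Prop :=
  ∃ m, Even m ∧ {k | s k = m}.Infinite ∧ ∀ m', {k | s k = m'}.Infinite → m' ≤ m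

/-- The two players of an infinite game. -/
inductive Player
  | one
  | two

/-- The opponent of a player. -/
def Player.other : Player → Player
  | .one => .two
  | .two => .one

/-- A parity game graph: every element of `V` is a vertex, owned by a player,
with edge relation `E` and coloring `color`. -/
structure GameGraph (V : Type) where
  owner : V → Player
  E : V → V → Prop
  color : V → ℕ

/-- The play `π` is won by player `p`: for Player II this means the maximal color
occurring infinitely often is even, for Player I that it is not. -/
def GameGraph.WonBy {V : Type} (G : GameGraph V) (p : Player) (π : ℕ → V) : Prop :=
  match p with
  | .two => MaxInfEven (fun n => G.color (π n))
  | .one => ¬ MaxInfEven (fun n => G.color (π n))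

/-- The finite prefix `π 0, …, π n` of an infinite sequence, as a list. -/
def hist {V : Type} (π : ℕ → V) (n : ℕ) : List V :=
  List.ofFn (fun i : Fin (n + 1) => π i.val)

/-- Finite play prefixes from `u₀` in which player `p` always moves according to
the strategy `σ` (given as a function from nonempty play prefixes to vertices). -/
inductive ConsHist {V : Type} (G : GameGraph V) (p : Player) (σ : List V → V) (u₀ : V) :
    List V → Prop
  | init : ConsHist G p σ u₀ [u₀]
  | ownStep (l : List V) (v : V) : ConsHist G p σ u₀ l → l.getLast? = some v →
      G.owner v = p → ConsHist G p σ u₀ (l ++ [σ l])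
  | oppStep (l : List V) (v w : V) : ConsHist G p σ u₀ l → l.getLast? = some v →
      G.owner v ≠ p → G.E v w → ConsHist G p σ u₀ (l ++ [w])

/-- `σ` is a (legal) strategy for player `p` from `u₀`: at every play prefix from `u₀`
consistent with `σ` and ending in a vertex of `p`, the prescribed move is along an edge. -/
def IsStrategyFrom {V : Type} (G : GameGraph V) (p : Player) (σ : List V → V) (u₀ : V) : Prop :=
  ∀ l v, ConsHist G p σ u₀ l → l.getLast? = some v → G.owner v = p → G.E v (σ l)

/-- `π` is an infinite play from `u₀`. -/
def IsPlayFrom {V : Type} (G : GameGraph V) (u₀ : V) (π : ℕ → V) : Prop :=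
  π 0 = u₀ ∧ ∀ n, G.E (π n) (π (n + 1))

/-- In the play `π`, player `p` always moves according to the strategy `σ`. -/
def ConsistentPlay {V : Type} (G : GameGraph V) (p : Player) (σ : List V → V) (π : ℕ → V) :
    Prop :=
  ∀ n, G.owner (π n) = p → π (n + 1) = σ (hist π n)

/-- `σ` is a winning strategy for player `p` from `u₀`. -/
def WinningStrategyFrom {V : Type} (G : GameGraph V) (p : Player) (σ : List V → V) (u₀ : V) :
    Prop :=
  IsStrategyFrom G p σ u₀ ∧
    ∀ π, IsPlayFrom G u₀ π → ConsistentPlay G p σ π → G.WonBy p π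

/-- The strategy induced by a memoryless strategy `f` (depending only on the last vertex). -/
def liftMemoryless {V : Type} (f : V → V) (u₀ : V) : List V → V :=
  fun l => f (l.getLast?.getD u₀)

/-- The memoryless strategy `f` is a winning strategy for player `p` from `u₀`. -/
def MemorylessWinningFrom {V : Type} (G : GameGraph V) (p : Player) (f : V → V) (u₀ : V) :
    Prop :=
  WinningStrategyFrom G p (liftMemoryless f u₀) u₀

/-- The winning region of player `p`: the vertices from which `p` has a winning strategy. -/
def WinningRegion {V : Type} (G : GameGraph V) (p : Player) : Set V :=
  {u | ∃ σ, WinningStrategyFrom G p σ u}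

/-- A pushdown rule `a p → v q`: `pop = some a` means the rule `a p → v q` with
`a ∈ A`, and `pop = none` means the bottom rule `⊥ p → ⊥ v q`. -/
structure PDRule (A P : Type) where
  pop : Option A
  src : P
  push : List A
  dst : P

/-- The rule `r` is applicable at the vertex `v = (w, p)` and yields the vertex `v'`:
for `pop = some a`, `v = (w a, p)` and `v' = (w ++ push, q)` (top of stack at the right
end); for `pop = none`, `v = (ε, p)` and `v' = (push, q)`. -/
def RuleStep {A P : Type} (r : PDRule A P) (v v' : List A × P) : Prop :=
  r.src = v.2 ∧ r.dst = v'.2 ∧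
    ((∃ (w : List A) (a : A), r.pop = some a ∧ v.1 = w ++ [a] ∧ v'.1 = w ++ r.push) ∨
      (r.pop = none ∧ v.1 = [] ∧ v'.1 = r.push))

/-- The pushdown parity game graph induced by the pushdown parity game system
`(pOwner, Δ, c)` over `A`: vertices are pairs (stack content, control state). -/
def pushdownGame {A P : Type} (pOwner : P → Player) (Δ : Finset (PDRule A P)) (c : P → ℕ) :
    GameGraph (List A × P) :=
  ⟨fun v => pOwner v.2, fun v v' => ∃ r ∈ Δ, RuleStep r v v', fun v => c v.2⟩

/-- The vertices arising in some play from `v₀` in which player `p` moves according to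
the memoryless strategy `f`. -/
inductive Reach {V : Type} (G : GameGraph V) (p : Player) (f : V → V) (v₀ : V) : V → Prop
  | base : Reach G p f v₀ v₀
  | ownStep {v : V} : Reach G p f v₀ v → G.owner v = p → Reach G p f v₀ (f v)
  | oppStep {v w : V} : Reach G p f v₀ v → G.owner v ≠ p → G.E v w → Reach G p f v₀ w

/-- The tree `t` of instructions determines the memoryless strategy `f` of player `pl`
from `v₀`: at every vertex `(w, p)` of player `pl` arising in a play from `v₀` following
`f`, the rule `[t w] p` (a rule of `Δ`) is applicable and yields the vertex `f (w, p)`. -/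
def Determines {A P : Type} (pOwner : P → Player) (Δ : Finset (PDRule A P)) (c : P → ℕ)
    (pl : Player)
    (t : List A → ({p : P // pOwner p = pl} → {r : PDRule A P // r ∈ Δ}))
    (f : List A × P → List A × P) (v₀ : List A × P) : Prop :=
  ∀ v : List A × P, Reach (pushdownGame pOwner Δ c) pl f v₀ v →
    ∀ h : pOwner v.2 = pl, RuleStep (t v.1 ⟨v.2, h⟩).val v (f v)

/-- A function on finite words is regular if it is computed by a deterministic finite
automaton with output (Moore machine): the output after reading `w` is `f w`. -/
def RegularFun {A I : Type} (f : List A → I) : Prop :=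
  ∃ (n : ℕ) (s0 : Fin n) (δ : Fin n → A → Fin n) (out : Fin n → I),
    ∀ w : List A, f w = out (w.foldl δ s0)

/-! ### Parity condition -/

theorem not_maxInfEven_of_odd {s : ℕ → ℕ} {m N : ℕ} (hm : Odd m) (hle : ∀ k ≥ N, s k ≤ m)
    (hio : ∀ n, ∃ k ≥ n, s k = m) : ¬ MaxInfEven s := by
  rintro ⟨e, he, hinf, hmax⟩
  have h1 : m ≤ e := by
    refine hmax m (Set.infinite_of_not_bddAbove ?_)
    rintro ⟨b, hb⟩
    obtain ⟨k, hk, hs⟩ := hio (b + 1)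
    have := hb hs
    omega
  obtain ⟨k, hk, hN⟩ := hinf.exists_gt N
  have h2 := hle k hN.le
  simp only [Set.mem_ofPred_eq] at hk
  have : e = m := by omega
  exact (Nat.not_even_iff_odd.2 hm) (this ▸ he)

theorem exists_odd_of_not_maxInfEven {s : ℕ → ℕ} {d : ℕ} (hd : ∀ k, s k ≤ d)
    (h : ¬ MaxInfEven s) :
    ∃ m, Odd m ∧ (∃ N, ∀ k ≥ N, s k ≤ m) ∧ ∀ n, ∃ k ≥ n, s k = m := by
  classical
  have hbd : ∀ m, {k | s k = m}.Infinite → m ≤ d := by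
    intro m hm
    obtain ⟨k, hk⟩ := hm.nonempty
    exact hk ▸ hd k
  have hex : ∃ m ≤ d, {k | s k = m}.Infinite := by
    by_contra! hcon
    have hfin : (⋃ m ∈ Set.Iic d, {k | s k = m}).Finite :=
      (Set.finite_Iic d).biUnion fun m hm => hcon m hm
    exact Set.infinite_univ (hfin.subset fun k _ => by simpa using hd k)
  obtain ⟨m₀, hm₀, hinf₀⟩ := hex
  let m := Nat.findGreatest (fun m => {k | s k = m}.Infinite) d
  have hinf : {k | s k = m}.Infinite :=
    Nat.findGreatest_spec (P := fun m => {k | s k = m}.Infinite) hm₀ hinf₀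
  have hmax : ∀ m', {k | s k = m'}.Infinite → m' ≤ m := fun m' hm' =>
    Nat.le_findGreatest (hbd m' hm') hm'
  refine ⟨m, ?_, ?_, ?_⟩
  · by_contra hodd
    exact h ⟨m, Nat.not_odd_iff_even.1 hodd, hinf, hmax⟩
  · have hfin : (⋃ i ∈ Set.Ioc m d, {k | s k = i}).Finite := by
      refine (Set.finite_Ioc m d).biUnion fun i hi => Set.not_infinite.1 fun hi' => ?_
      exact absurd (hmax i hi') (not_le.2 hi.1)
    obtain ⟨b, hb⟩ := hfin.bddAbove
    refine ⟨b + 1, fun k hk => ?_⟩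
    by_contra! hlt
    have : k ≤ b := hb (by simpa using ⟨hlt, hd k⟩)
    omega
  · intro n
    obtain ⟨k, hk, hn⟩ := hinf.exists_gt n
    exact ⟨k, hn.le, hk⟩

/-! ### Signatures -/

/-- Signatures: tuples of ordinals indexed by colors, ordered lexicographically with the
largest color most significant. -/
def Sig (d : ℕ) : Type 1 := Colex (Fin (d + 1) → Ordinal.{0})

namespace Sig

variable {d : ℕ}

noncomputable instance : LinearOrder (Sig d) :=
  inferInstanceAs (LinearOrder (Colex (Fin (d + 1) → Ordinal.{0})))

instance : WellFoundedLT (Sig d) :=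
  ⟨(wellFounded_lt : WellFounded
    ((· < ·) : Colex (Fin (d + 1) → Ordinal.{0}) → Colex (Fin (d + 1) → Ordinal.{0}) → Prop))⟩

/-- The part of a signature belonging to the colors `≥ m`. -/
noncomputable def trunc (m : ℕ) (s : Sig d) : Sig d :=
  toColex fun i => if m ≤ i.val then ofColex s i else 0

theorem trunc_mono (m : ℕ) {s s' : Sig d} (h : s ≤ s') : trunc m s ≤ trunc m s' := by
  rcases h.eq_or_lt with rfl | ⟨i, hi, hlt⟩
  · exact le_rfl
  · by_cases hm : m ≤ i.val
    · refine le_of_lt ⟨i, fun j hj => ite_congr rfl (fun _ => hi j hj) fun _ => rfl, ?_⟩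
      exact (if_pos hm).trans_lt (hlt.trans_eq (if_pos hm).symm)
    · refine le_of_eq ?_
      refine congrArg toColex (funext fun j => ?_)
      split_ifs with hj
      · exact hi j (Fin.lt_def.2 (by omega))
      · rfl

theorem trunc_trunc (m n : ℕ) (s : Sig d) : trunc m (trunc n s) = trunc (max m n) s := by
  refine congrArg toColex (funext fun j => ?_)
  simp only [trunc, ofColex_toColex, max_le_iff]
  split_ifs <;> first | rfl | omega

theorem trunc_le_trunc_of_le {m n : ℕ} (hmn : m ≤ n) {s s' : Sig d}
    (h : trunc m s ≤ trunc m s') : trunc n s ≤ trunc n s' := by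
  simpa [trunc_trunc, hmn] using trunc_mono n h

/-- `Progress m s' s`: passing from signature `s` to signature `s'` is allowed when `m` is the
largest color seen in between. -/
def Progress (m : ℕ) (s' s : Sig d) : Prop :=
  trunc m s' ≤ trunc m s ∧ (Odd m → trunc m s' < trunc m s)

theorem progress_zero {s s' : Sig d} (h : s' ≤ s) : Progress 0 s' s :=
  ⟨trunc_mono 0 h, fun h0 => absurd h0 (by decide)⟩

theorem Progress.comp {m n : ℕ} {s s' s'' : Sig d} (h : Progress m s' s)
    (h' : Progress n s'' s') : Progress (max m n) s'' s := by
  have h1 := trunc_le_trunc_of_le (le_max_left m n) h.1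
  have h2 := trunc_le_trunc_of_le (le_max_right m n) h'.1
  refine ⟨h2.trans h1, fun hodd => ?_⟩
  rcases le_total m n with hmn | hmn
  · rw [max_eq_right hmn] at *
    exact (h'.2 hodd).trans_le h1
  · rw [max_eq_left hmn] at *
    exact h2.trans_lt (h.2 hodd)

theorem Progress.of_le {m : ℕ} {s s' s'' : Sig d} (hs : s'' ≤ s') (h : Progress m s' s) :
    Progress m s'' s := by
  simpa using h.comp (progress_zero hs)

theorem not_progress_chain {m : ℕ} (hm : Odd m) (a : ℕ → Sig d) :
    ¬ ∀ n, Progress m (a (n + 1)) (a n) := by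
  intro h
  exact (wellFounded_iff_isEmpty_descending_chain.1
    (wellFounded_lt : WellFounded ((· < ·) : Sig d → Sig d → Prop))).false
    ⟨fun n => trunc m (a n), fun n => (h n).2 hm⟩

end Sig

/-! ### Progress measures from winning strategies -/

section History

variable {V : Type} {G : GameGraph V} {p : Player} {σ : List V → V} {u₀ : V}

theorem ConsHist.snoc {l : List V} {v x : V} (h : ConsHist G p σ u₀ l)
    (hv : l.getLast? = some v) (hE : G.E v x) (hx : G.owner v = p → x = σ l) :
    ConsHist G p σ u₀ (l ++ [x]) := by
  by_cases ho : G.owner v = p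
  · exact hx ho ▸ ConsHist.ownStep l v h hv ho
  · exact ConsHist.oppStep l v x h hv ho hE

theorem getD_length_sub_one {l : List V} {v : V} (hv : l.getLast? = some v) (u : V) :
    l ≠ [] ∧ l.getD (l.length - 1) u = v := by
  obtain ⟨l', rfl⟩ := List.getLast?_eq_some_iff.1 hv
  simp

theorem ConsHist.spec (hσ : IsStrategyFrom G p σ u₀) {l : List V} (h : ConsHist G p σ u₀ l) :
    l.getD 0 u₀ = u₀ ∧ ∀ i, i + 1 < l.length →
      G.E (l.getD i u₀) (l.getD (i + 1) u₀) ∧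
      (G.owner (l.getD i u₀) = p → l.getD (i + 1) u₀ = σ (l.take (i + 1))) := by
  have key : ∀ (l : List V) (v x : V), l.getLast? = some v → G.E v x →
      (G.owner v = p → x = σ l) →
      (l.getD 0 u₀ = u₀ ∧ ∀ i, i + 1 < l.length →
        G.E (l.getD i u₀) (l.getD (i + 1) u₀) ∧
        (G.owner (l.getD i u₀) = p → l.getD (i + 1) u₀ = σ (l.take (i + 1)))) →
      ((l ++ [x]).getD 0 u₀ = u₀ ∧ ∀ i, i + 1 < (l ++ [x]).length →
        G.E ((l ++ [x]).getD i u₀) ((l ++ [x]).getD (i + 1) u₀) ∧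
        (G.owner ((l ++ [x]).getD i u₀) = p →
          (l ++ [x]).getD (i + 1) u₀ = σ ((l ++ [x]).take (i + 1)))) := by
    intro l v x hv hE hx ⟨h0, hl⟩
    obtain ⟨hne, hlast⟩ := getD_length_sub_one hv u₀
    have hpos := List.length_pos_iff.2 hne
    refine ⟨by rw [List.getD_append _ _ _ _ hpos]; exact h0, fun i hi => ?_⟩
    rw [List.length_append, List.length_singleton] at hi
    rcases lt_or_ge (i + 1) l.length with hlt | hge
    · rw [List.getD_append _ _ _ _ hlt, List.getD_append _ _ _ _ (by omega),
        List.take_append_of_le_length hlt.le]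
      exact hl i hlt
    · obtain rfl : i = l.length - 1 := by omega
      have h1 : l.length - 1 + 1 = l.length := by omega
      rw [h1, List.getD_append _ _ _ _ (by omega), hlast, List.take_left,
        List.getD_append_right _ _ _ _ le_rfl]
      simpa using ⟨hE, hx⟩
  induction h with
  | init => simp
  | ownStep l v hl hv ho ih => exact key l v _ hv (hσ l v hl hv ho) (fun _ => rfl) ih
  | oppStep l v w hl hv ho hE ih => exact key l v w hv hE (fun h => absurd h ho) ih

/-- `Extends G p σ u₀ m l' l`: the consistent history `l'` prolongs `l`, and `m` is the largest
color that is left on the way. -/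
def Extends (G : GameGraph V) (p : Player) (σ : List V → V) (u₀ : V) (m : ℕ)
    (l' l : List V) : Prop :=
  ConsHist G p σ u₀ l' ∧ l <+: l' ∧
    (∀ i, l.length ≤ i + 1 → i + 1 < l'.length → G.color (l'.getD i u₀) ≤ m) ∧
    ∃ i, l.length ≤ i + 1 ∧ i + 1 < l'.length ∧ G.color (l'.getD i u₀) = m

theorem List.IsPrefix.getD_eq {l l' : List V} (h : l <+: l') {i : ℕ} (hi : i < l.length)
    (u : V) : l'.getD i u = l.getD i u := by
  obtain ⟨t, rfl⟩ := h
  exact List.getD_append _ _ _ _ hi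

theorem wellFounded_extends (hσ : WinningStrategyFrom G .two σ u₀) {m : ℕ} (hm : Odd m) :
    WellFounded (Extends G .two σ u₀ m) := by
  rw [wellFounded_iff_isEmpty_descending_chain]
  refine ⟨fun ⟨g, hg⟩ => ?_⟩
  have hlt : ∀ n, (g n).length < (g (n + 1)).length := fun n => by
    obtain ⟨-, -, -, i, h1, h2, -⟩ := hg n
    omega
  have hmono : StrictMono fun n => (g n).length := strictMono_nat_of_lt_succ hlt
  have hlen : ∀ n, n ≤ (g n).length := fun n => hmono.id_le n
  have hpre : ∀ n k, n ≤ k → g n <+: g k := fun n k hnk => by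
    induction hnk with
    | refl => exact List.prefix_rfl
    | step _ ih => exact ih.trans (hg _).2.1
  let π : ℕ → V := fun n => (g (n + 1)).getD n u₀
  have hπ : ∀ k i, i < (g k).length → (g k).getD i u₀ = π i := by
    intro k i hi
    have hi' : i < (g (i + 1)).length := hlen (i + 1)
    rw [← (hpre k _ (le_max_left k (i + 1))).getD_eq hi,
      (hpre (i + 1) _ (le_max_right k (i + 1))).getD_eq hi']
  have hspec : ∀ n, _ := fun n => (hg n).1.spec hσ.1
  have hhist : ∀ n, (g (n + 2)).take (n + 1) = hist π n := fun n => by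
    have := hlen (n + 2)
    refine List.ext_getElem (by simp [hist]; omega) fun i h1 h2 => ?_
    have hi : i < (g (n + 2)).length := by simp at h1; omega
    have := hπ (n + 2) i hi
    rw [List.getD_eq_getElem _ _ hi] at this
    simpa only [hist, List.getElem_take, List.getElem_ofFn] using this
  have hstep : ∀ n, G.E (π n) (π (n + 1)) ∧ (G.owner (π n) = .two → π (n + 1) = σ (hist π n)) := by
    intro n
    have hl : n + 2 ≤ (g (n + 1 + 1)).length := hlen (n + 2)
    have := (hspec (n + 1)).2 n (by omega)
    rwa [hπ _ _ (by omega), hπ _ _ (by omega), hhist] at this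
  have hwon := hσ.2 π ⟨by
    rw [← hπ 1 0 (by have := hlen 1; omega)]; exact (hspec 0).1, fun n => (hstep n).1⟩
    fun n => (hstep n).2
  refine not_maxInfEven_of_odd (N := (g 0).length) hm (fun k hk => ?_) (fun n => ?_) hwon
  · have hex : ∃ n, k + 1 < (g n).length := ⟨k + 2, hlen (k + 2)⟩
    classical
    have hfind := Nat.find_spec hex
    obtain ⟨n, hn⟩ : ∃ n, Nat.find hex = n + 1 := by
      refine Nat.exists_eq_succ_of_ne_zero fun h0 => ?_
      rw [h0] at hfind
      omega
    have hmin := Nat.find_min hex (m := n) (by omega)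
    rw [hn] at hfind
    rw [← hπ (n + 1) k (by omega)]
    exact (hg n).2.2.1 k (by omega) hfind
  · obtain ⟨-, -, -, i, h1, h2, h3⟩ := hg (n + 1)
    refine ⟨i, by have := hlen (n + 1); omega, ?_⟩
    rwa [← hπ (n + 1 + 1) i (by omega)]

theorem extends_snoc_trans {m : ℕ} {l l'' : List V} {v x : V} (hv : l.getLast? = some v)
    (hm : G.color v ≤ m) (h : Extends G p σ u₀ m l'' (l ++ [x])) :
    Extends G p σ u₀ m l'' l := by
  obtain ⟨hc, hpre, hall, i, h1, h2, h3⟩ := h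
  obtain ⟨hne, hlast⟩ := getD_length_sub_one hv u₀
  have hpos := List.length_pos_iff.2 hne
  have hpre' := (List.prefix_append l [x]).trans hpre
  simp only [List.length_append, List.length_singleton] at h1 hall
  refine ⟨hc, hpre', fun j hj hj' => ?_, i, by omega, h2, h3⟩
  rcases hj.eq_or_lt with heq | hlt
  · obtain rfl : j = l.length - 1 := by omega
    rwa [hpre'.getD_eq (by omega), hlast]
  · exact hall j hlt hj'

theorem extends_snoc {l : List V} {v x : V} (hv : l.getLast? = some v)
    (h : ConsHist G p σ u₀ (l ++ [x])) : Extends G p σ u₀ (G.color v) (l ++ [x]) l := by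
  obtain ⟨hne, hlast⟩ := getD_length_sub_one hv u₀
  have hpos := List.length_pos_iff.2 hne
  have hcol : ∀ i, l.length ≤ i + 1 → i + 1 < (l ++ [x]).length →
      G.color ((l ++ [x]).getD i u₀) = G.color v := fun i h1 h2 => by
    rw [List.length_append, List.length_singleton] at h2
    obtain rfl : i = l.length - 1 := by omega
    rw [List.getD_append _ _ _ _ (by omega), hlast]
  refine ⟨h, List.prefix_append _ _, fun i h1 h2 => (hcol i h1 h2).le, l.length - 1, by omega, ?_,
    hcol _ (by omega) ?_⟩ <;>
  · rw [List.length_append, List.length_singleton]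
    omega

/-- The signature of a history: for every odd color `m`, the rank of the history in the
well-founded relation of prolongations with largest color `m`. -/
noncomputable def histSig (d : ℕ) (hσ : WinningStrategyFrom G .two σ u₀) (l : List V) : Sig d :=
  toColex fun i => if h : Odd i.val then ((wellFounded_extends hσ h).apply l).rank else 0

theorem progress_histSig {d : ℕ} (hσ : WinningStrategyFrom G .two σ u₀) {l : List V} {v x : V}
    (hv : l.getLast? = some v) (hd : G.color v ≤ d) (h : ConsHist G .two σ u₀ (l ++ [x])) :
    Sig.Progress (G.color v) (histSig d hσ (l ++ [x])) (histSig d hσ l) := by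
  have hle : ∀ i : Fin (d + 1),
      (if G.color v ≤ i.val then ofColex (histSig d hσ (l ++ [x])) i else 0) ≤
        (if G.color v ≤ i.val then ofColex (histSig d hσ l) i else 0) := by
    intro i
    simp only [histSig, ofColex_toColex]
    split_ifs with h1 h2
    · rw [Acc.rank_eq ((wellFounded_extends hσ h2).apply (l ++ [x]))]
      exact ciSup_le' fun b => Order.succ_le_of_lt <| Acc.rank_lt_of_rel
        ((wellFounded_extends hσ h2).apply l) (extends_snoc_trans hv h1 b.2)
    · exact le_rfl
    · exact le_rfl
  refine ⟨Pi.toColex_monotone hle, fun hodd => Pi.toColex_strictMono ?_⟩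
  refine Pi.lt_def.2 ⟨hle, ⟨G.color v, by omega⟩, ?_⟩
  simp only [histSig, ofColex_toColex, le_refl, if_true, hodd, dif_pos]
  exact Acc.rank_lt_of_rel ((wellFounded_extends hσ hodd).apply l) (extends_snoc hv h)

/-- A winning strategy yields a progress measure together with a memoryless choice of
successors along which the measure progresses. -/
theorem exists_progressMeasure {d : ℕ} (hd : ∀ v, G.color v ≤ d)
    (hσ : WinningStrategyFrom G .two σ u₀) :
    ∃ (Live : V → Prop) (M : V → Sig d) (next : V → V), Live u₀ ∧ ∀ v, Live v →
      (G.owner v = .two → G.E v (next v)) ∧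
      ∀ v', G.E v v' → (G.owner v = .two → v' = next v) →
        Live v' ∧ Sig.Progress (G.color v) (M v') (M v) := by
  classical
  let S : V → Set (List V) := fun v => {l | ConsHist G .two σ u₀ l ∧ l.getLast? = some v}
  have hbest : ∀ v, ∃ l, (S v).Nonempty →
      l ∈ S v ∧ ∀ l' ∈ S v, histSig d hσ l ≤ histSig d hσ l' := by
    intro v
    by_cases hv : (S v).Nonempty
    · refine ⟨Function.argminOn (histSig d hσ) (S v) hv, fun _ =>
        ⟨Function.argminOn_mem _ _ hv, fun l' hl' => ?_⟩⟩
      exact Function.argminOn_le _ _ hl'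
    · exact ⟨[], fun h => absurd h hv⟩
  choose best hb using hbest
  refine ⟨fun v => (S v).Nonempty, fun v => histSig d hσ (best v), fun v => σ (best v),
    ⟨[u₀], .init, rfl⟩, fun v hv => ?_⟩
  obtain ⟨⟨hc, hl⟩, -⟩ := hb v hv
  refine ⟨fun ho => hσ.1 _ _ hc hl ho, fun v' hE ho => ?_⟩
  have hc' := hc.snoc hl hE ho
  have hmem : best v ++ [v'] ∈ S v' := ⟨hc', by simp⟩
  exact ⟨⟨_, hmem⟩, (progress_histSig hσ hl (hd v) hc').of_le ((hb v' ⟨_, hmem⟩).2 _ hmem)⟩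

end History

/-! ### Pushdown games -/

section Pushdown

variable {A P : Type} {pOwner : P → Player} {Δ : Finset (PDRule A P)} {c : P → ℕ}

theorem ruleStep_iff {r : PDRule A P} {v v' : List A × P} :
    RuleStep r v v' ↔ r.src = v.2 ∧ r.dst = v'.2 ∧ r.pop = v.1.getLast? ∧
      v'.1 = v.1.dropLast ++ r.push := by
  unfold RuleStep
  refine and_congr_right fun _ => and_congr_right fun _ => ?_
  rcases v.1.eq_nil_or_concat' with h | ⟨u, b, h⟩
  · simp [h]
  · rw [h]
    constructor
    · rintro (⟨w, a, h1, h2, h3⟩ | ⟨-, h2, -⟩)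
      · obtain ⟨rfl, h4⟩ := List.append_inj' h2 rfl
        obtain rfl : b = a := by simpa using h4
        simp [h1, h3]
      · simp at h2
    · rintro ⟨h1, h2⟩
      exact .inl ⟨u, b, by simpa using h1, rfl, by simpa using h2⟩

theorem RuleStep.unique {r : PDRule A P} {v v' v'' : List A × P} (h : RuleStep r v v')
    (h' : RuleStep r v v'') : v' = v'' := by
  rw [ruleStep_iff] at h h'
  exact Prod.ext (h.2.2.2.trans h'.2.2.2.symm) (h.2.1.symm.trans h'.2.1)

/-- The rule `r` of `Δ` may be used where Player II plays by the instruction `i`. -/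
def Permitted (i : {p : P // pOwner p = .two} → {r : PDRule A P // r ∈ Δ})
    (r : PDRule A P) : Prop :=
  r ∈ Δ ∧ ∀ h : pOwner r.src = .two, r = (i ⟨r.src, h⟩).val

/-- On the set `Live` of configurations the instruction tree `t` is applicable, and `M` is a
progress measure along the moves it permits. -/
def IsMeasured {d : ℕ} (c : P → ℕ)
    (t : List A → ({p : P // pOwner p = .two} → {r : PDRule A P // r ∈ Δ}))
    (Live : List A × P → Prop) (M : List A × P → Sig d) : Prop :=
  ∀ v, Live v →
    (∀ h : pOwner v.2 = .two, ∃ v', RuleStep (t v.1 ⟨v.2, h⟩).val v v') ∧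
    ∀ r v', Permitted (t v.1) r → RuleStep r v v' →
      Live v' ∧ Sig.Progress (c v.2) (M v') (M v)

theorem exists_isMeasured {d : ℕ} (hd : ∀ p, c p ≤ d)
    (htot : ∀ v, ∃ w, (pushdownGame pOwner Δ c).E v w) {v₀ : List A × P}
    {σ : List (List A × P) → List A × P}
    (hσ : WinningStrategyFrom (pushdownGame pOwner Δ c) .two σ v₀) :
    ∃ (t : List A → ({p : P // pOwner p = .two} → {r : PDRule A P // r ∈ Δ}))
      (Live : List A × P → Prop) (M : List A × P → Sig d),
      Live v₀ ∧ IsMeasured c t Live M := by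
  obtain ⟨Live, M, next, h₀, hM⟩ := exists_progressMeasure (fun v => hd v.2) hσ
  have hr : ∀ (w : List A) (p : P), ∃ r : {r : PDRule A P // r ∈ Δ},
      (pushdownGame pOwner Δ c).E (w, p) (next (w, p)) →
        RuleStep r.val (w, p) (next (w, p)) := by
    intro w p
    by_cases h : (pushdownGame pOwner Δ c).E (w, p) (next (w, p))
    · obtain ⟨r, hr, hs⟩ := h
      exact ⟨⟨r, hr⟩, fun _ => hs⟩
    · obtain ⟨_, r, hr, -⟩ := htot (w, p)
      exact ⟨⟨r, hr⟩, fun h' => absurd h' h⟩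
  choose rule hrule using hr
  refine ⟨fun w p => rule w p.val, Live, M, h₀, fun v hv => ?_⟩
  obtain ⟨hown, hstep⟩ := hM v hv
  refine ⟨fun h => ⟨_, hrule v.1 v.2 (hown h)⟩, fun r v' hp hs => ?_⟩
  refine hstep v' ⟨r, hp.1, hs⟩ fun h => ?_
  have hsrc : r.src = v.2 := hs.1
  have h1 : r = (rule v.1 r.src).val := hp.2 (by rw [hsrc]; exact h)
  rw [hsrc] at h1
  exact hs.unique (h1 ▸ hrule v.1 v.2 (hown h))

/-! ### Summaries of descending play segments -/

/-- Plays with a pending part: `Exit c t u z m z'` says that from the configuration with stack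
`u ++ z.1` and control state `z.2`, the instruction tree `t` admits a play in which the letters
of `z.1` are reintroduced one at a time, and that first shortens `u` when reaching stack
`u.dropLast ++ z'.1` and control state `z'.2`, with largest color `m`. -/
inductive Exit (c : P → ℕ)
    (t : List A → ({p : P // pOwner p = .two} → {r : PDRule A P // r ∈ Δ})) :
    List A → List A × P → ℕ → List A × P → Prop
  | pop (u : List A) (r : PDRule A P) : Permitted (t u) r → r.pop = u.getLast? →
      Exit c t u ([], r.src) (c r.src) (r.push, r.dst)
  | push (u : List A) (b : A) (v : List A) (q : P) (m₁ m₂ : ℕ) (z₁ z₂ : List A × P) :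
      Exit c t (u ++ [b]) (v, q) m₁ z₁ → Exit c t u z₁ m₂ z₂ →
      Exit c t u (b :: v, q) (max m₁ m₂) z₂

variable {t : List A → ({p : P // pOwner p = .two} → {r : PDRule A P // r ∈ Δ})}

/-- The configuration represented by stack `u` with pending part `z`. -/
def glue (u : List A) (z : List A × P) : List A × P := (u ++ z.1, z.2)

theorem Exit.progress {d : ℕ} {Live : List A × P → Prop} {M : List A × P → Sig d}
    (hM : IsMeasured c t Live M) {u : List A} {z z' : List A × P} {m : ℕ}
    (h : Exit c t u z m z') (hl : Live (glue u z)) :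
    Live (glue u.dropLast z') ∧
      Sig.Progress m (M (glue u.dropLast z')) (M (glue u z)) := by
  induction h with
  | pop u r hp hpop =>
    have hs : RuleStep r (glue u ([], r.src)) (glue u.dropLast (r.push, r.dst)) := by
      simp [ruleStep_iff, glue, hpop]
    exact (hM _ hl).2 r _ (by simpa [glue] using hp) hs
  | push u b v q m₁ m₂ z₁ z₂ _ _ ih₁ ih₂ =>
    have hg : glue (u ++ [b]) (v, q) = glue u (b :: v, q) := by simp [glue]
    rw [hg, List.dropLast_concat] at ih₁
    obtain ⟨hl₁, h₁⟩ := ih₁ hl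
    obtain ⟨hl₂, h₂⟩ := ih₂ hl₁
    exact ⟨hl₂, h₁.comp h₂⟩

theorem Exit.bounds {L d : ℕ} (hL : ∀ r ∈ Δ, r.push.length ≤ L) (hd : ∀ p, c p ≤ d)
    {u : List A} {z z' : List A × P} {m : ℕ} (h : Exit c t u z m z') :
    m ≤ d ∧ z'.1.length ≤ L := by
  induction h with
  | pop u r hp _ => exact ⟨hd _, hL r hp.1⟩
  | push _ _ _ _ _ _ _ _ _ _ ih₁ ih₂ => exact ⟨max_le ih₁.1 ih₂.1, ih₂.2⟩

/-! ### Representatives of stacks -/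

theorem exists_finite_representatives {X α : Type*} [PartialOrder α] [WellQuasiOrderedLE α]
    (g : X → α) : ∃ rep : X → X, (Set.range rep).Finite ∧ ∀ x, g (rep x) ≤ g x := by
  have hpwo := Set.isPWO_of_wellQuasiOrderedLE (Set.range g)
  let S : Set α := {a | Minimal (· ∈ Set.range g) a}
  have hS : S.Finite := (setOfPred_minimal_antichain _).finite_of_partiallyWellOrderedOn
    (hpwo.mono fun a ha => ha.prop)
  have hmin : ∀ x, ∃ a : S, a.val ≤ g x := fun x => by
    obtain ⟨a, ha, hmin⟩ := hpwo.exists_le_minimal ⟨x, rfl⟩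
    exact ⟨⟨a, hmin⟩, ha⟩
  have hpre : ∀ a : S, ∃ x, g x = a.val := fun a => a.2.prop
  choose low hlow using hmin
  choose pre hpre using hpre
  have : Finite S := hS
  refine ⟨fun x => pre (low x), (Set.finite_range pre).subset ?_, fun x => ?_⟩
  · rintro _ ⟨x, rfl⟩
    exact ⟨_, rfl⟩
  · rw [hpre]
    exact hlow x

/-- As far as pending parts of length at most `L` are concerned, the stack `u'` is at least as
good for Player II as the stack `u`. -/
structure Simulates {d : ℕ} (c : P → ℕ)
    (t : List A → ({p : P // pOwner p = .two} → {r : PDRule A P // r ∈ Δ}))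
    (Live : List A × P → Prop) (M : List A × P → Sig d) (L : ℕ) (u' u : List A) : Prop where
  getLast?_eq : u'.getLast? = u.getLast?
  exit : ∀ {z m z'}, z.1.length ≤ L → Exit c t u' z m z' → Exit c t u z m z'
  live : ∀ {z}, z.1.length ≤ L → Live (glue u z) → Live (glue u' z)
  measure_le : ∀ {z}, z.1.length ≤ L → M (glue u' z) ≤ M (glue u z)

theorem exists_simulates [Finite A] [Finite P] {L d : ℕ} (hL : ∀ r ∈ Δ, r.push.length ≤ L)
    (hd : ∀ p, c p ≤ d) (Live : List A × P → Prop) (M : List A × P → Sig d) :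
    ∃ rep : List A → List A, (Set.range rep).Finite ∧
      ∀ u, Simulates c t Live M L (rep u) u := by
  let Z := {z : List A × P // z.1.length ≤ L}
  have : Finite Z := by
    have h := (List.finite_length_le A L).prod (Set.finite_univ (α := P))
    exact (h.subset fun z hz => ⟨hz, trivial⟩ : {z : List A × P | z.1.length ≤ L}.Finite)
  obtain ⟨rep, hfin, hrep⟩ := exists_finite_representatives
    (α := (Option A → Prop) × (Z × Fin (d + 1) × Z → Prop) × (Z → Prop) × (Z → Sig d))
    fun u : List A => (fun o => u.getLast? = o,
      fun x => Exit c t u x.1.val x.2.1.val x.2.2.val, fun z => ¬ Live (glue u z.val),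
      fun z => M (glue u z.val))
  refine ⟨rep, hfin, fun u => ?_⟩
  obtain ⟨h1, h2, h3, h4⟩ := hrep u
  refine ⟨(h1 _ rfl).symm, fun hz he => ?_, fun hz hl => ?_, fun hz => h4 ⟨_, hz⟩⟩
  · obtain ⟨hm, hz'⟩ := he.bounds hL hd
    exact h2 ⟨⟨_, hz⟩, ⟨_, Nat.lt_succ_of_le hm⟩, ⟨_, hz'⟩⟩ he
  · by_contra hcon
    exact h3 ⟨_, hz⟩ hcon hl

/-- The representative of a stack, computed letter by letter. -/
def foldRep (rep : List A → List A) (w : List A) : List A :=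
  w.foldl (fun u a => rep (u ++ [a])) []

@[simp]
theorem foldRep_nil (rep : List A → List A) : foldRep rep [] = [] := rfl

@[simp]
theorem foldRep_concat (rep : List A → List A) (w : List A) (b : A) :
    foldRep rep (w ++ [b]) = rep (foldRep rep w ++ [b]) := by
  simp [foldRep]

theorem regularFun_comp_foldRep {I : Type} {rep : List A → List A} (hrep : (Set.range rep).Finite)
    (t : List A → I) : RegularFun fun w => t (foldRep rep w) := by
  let S : Set (List A) := insert [] (Set.range rep)
  have : Finite S := hrep.insert []
  obtain ⟨n, ⟨e⟩⟩ := Finite.exists_equiv_fin S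
  let s₀ : S := ⟨[], Set.mem_insert _ _⟩
  let δ : S → A → S := fun u a => ⟨rep (u.val ++ [a]), Set.mem_insert_of_mem _ ⟨_, rfl⟩⟩
  refine ⟨n, e s₀, fun x a => e (δ (e.symm x) a), fun x => t (e.symm x).val, fun w => ?_⟩
  have key : ((e.symm (w.foldl (fun x a => e (δ (e.symm x) a)) (e s₀))).val : List A) =
      foldRep rep w := by
    induction w using List.reverseRecOn with
    | nil => simp [s₀]
    | append_singleton w b ih => simp [δ, ih]
  exact congrArg t key.symm

section Representative

variable {d L : ℕ} {Live : List A × P → Prop} {M : List A × P → Sig d}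
  {rep : List A → List A}

theorem getLast?_foldRep (hrep : ∀ u, Simulates c t Live M L (rep u) u) (w : List A) :
    (foldRep rep w).getLast? = w.getLast? := by
  rcases w.eq_nil_or_concat' with rfl | ⟨u, b, rfl⟩
  · rfl
  · rw [foldRep_concat, (hrep _).getLast?_eq]
    simp

theorem Exit.of_foldRep (hL : ∀ r ∈ Δ, r.push.length ≤ L) (hd : ∀ p, c p ≤ d)
    (hrep : ∀ u, Simulates c t Live M L (rep u) u) {w : List A} {z z' : List A × P} {m : ℕ}
    (h : Exit c (fun w => t (foldRep rep w)) w z m z') (hz : z.1.length ≤ L) :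
    Exit c t (foldRep rep w) z m z' := by
  induction h with
  | pop u r hp hpop => exact .pop _ r hp (by rw [hpop, getLast?_foldRep hrep])
  | push u b v q m₁ m₂ z₁ z₂ he _ ih₁ ih₂ =>
    rw [List.length_cons] at hz
    have hv : v.length ≤ L := by omega
    have h₁ := ih₁ hv
    rw [foldRep_concat] at h₁
    exact .push _ b v q m₁ m₂ z₁ z₂ ((hrep _).exit hv h₁) (ih₂ (he.bounds hL hd).2)

end Representative

/-! ### Plays with a pending part -/

/-- A move of a play with pending part: a pending letter is put on the stack, or, if there is
none, a permitted rule is applied, whose pushed word becomes the pending part. -/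
def PendingStep
    (t : List A → ({p : P // pOwner p = .two} → {r : PDRule A P // r ∈ Δ}))
    (x y : List A × List A × P) : Prop :=
  (∃ b v, x.2.1 = b :: v ∧ y = (x.1 ++ [b], v, x.2.2)) ∨
    (x.2.1 = [] ∧ ∃ r, Permitted (t x.1) r ∧ r.src = x.2.2 ∧ r.pop = x.1.getLast? ∧
      y = (x.1.dropLast, r.push, r.dst))

/-- The color of a configuration with pending part; only those without pending letters count. -/
def pendingColor (c : P → ℕ) (x : List A × List A × P) : ℕ :=
  if x.2.1 = [] then c x.2.2 else 0

/-- The largest color of `s` in the interval `[j, k)`. -/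
def maxColor (c : P → ℕ) (s : ℕ → List A × List A × P) (j k : ℕ) : ℕ :=
  (Finset.Ico j k).sup fun i => pendingColor c (s i)

section

variable {s : ℕ → List A × List A × P}

theorem maxColor_trans {i j k : ℕ} (hij : i ≤ j) (hjk : j ≤ k) :
    maxColor c s i k = max (maxColor c s i j) (maxColor c s j k) := by
  rw [maxColor, ← Finset.Ico_union_Ico_eq_Ico hij hjk, Finset.sup_union]
  rfl

theorem maxColor_succ (j : ℕ) : maxColor c s j (j + 1) = pendingColor c (s j) := by
  simp [maxColor]

theorem PendingStep.length {x y : List A × List A × P} (h : PendingStep t x y) :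
    y.1.length = x.1.length + 1 ∨ y.1.length = x.1.length - 1 := by
  rcases h with ⟨b, v, -, rfl⟩ | ⟨-, r, -, -, -, rfl⟩ <;> simp

theorem exit_of_segment {j k : ℕ} (hs : ∀ i, j ≤ i → i < k → PendingStep t (s i) (s (i + 1)))
    (hjk : j < k) (hk : (s k).1.length + 1 = (s j).1.length)
    (hlow : ∀ i, j ≤ i → i < k → (s k).1.length < (s i).1.length) :
    Exit c t (s j).1 (s j).2 (maxColor c s j k) (s k).2 ∧ (s k).1 = (s j).1.dropLast := by
  induction hn : k - j using Nat.strong_induction_on generalizing j k with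
  | _ n ih =>
    rcases hs j le_rfl hjk with ⟨b, v, hv, hnext⟩ | ⟨hv, r, hp, hsrc, hpop, hnext⟩
    · classical
      have hlen : (s (j + 1)).1.length = (s j).1.length + 1 := by simp [hnext]
      have hex : ∃ i, j + 1 ≤ i ∧ (s i).1.length ≤ (s j).1.length :=
        ⟨k, hjk, by omega⟩
      obtain ⟨i, hi⟩ : ∃ i, i = Nat.find hex := ⟨_, rfl⟩
      have hspec := Nat.find_spec hex
      have hmin := fun i' => Nat.find_min hex (m := i')
      have hik : Nat.find hex ≤ k := Nat.find_min' hex ⟨hjk, by omega⟩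
      rw [← hi] at hspec hmin hik
      have hne : i ≠ j + 1 := by rintro rfl; omega
      obtain ⟨i₀, rfl⟩ : ∃ i₀, i = i₀ + 1 := ⟨i - 1, by omega⟩
      have habove : ∀ i', j + 1 ≤ i' → i' < i₀ + 1 → (s j).1.length < (s i').1.length :=
        fun i' h1 h2 => by
          have := hmin i' h2
          omega
      have heq : (s (i₀ + 1)).1.length = (s j).1.length := by
        have h1 := habove i₀ (by omega) (by omega)
        have h2 := (hs i₀ (by omega) (by omega)).length
        omega
      have hlt : i₀ + 1 < k := by
        rcases hik.lt_or_eq with h | h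
        · exact h
        · rw [h] at heq
          omega
      obtain ⟨e₁, w₁⟩ := ih (i₀ + 1 - (j + 1)) (by omega)
        (fun i' h1 h2 => hs i' (by omega) (by omega)) (by omega) (by omega)
        (fun i' h1 h2 => by rw [heq]; exact habove i' h1 h2) rfl
      obtain ⟨e₂, w₂⟩ := ih (k - (i₀ + 1)) (by omega)
        (fun i' h1 h2 => hs i' (by omega) (by omega)) hlt (by omega)
        (fun i' h1 h2 => hlow i' (by omega) h2) rfl
      have hw : (s (i₀ + 1)).1 = (s j).1 := by simp [w₁, hnext]
      rw [hw] at e₂ w₂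
      refine ⟨?_, w₂⟩
      rw [hnext] at e₁
      have hsj : (s j).2 = (b :: v, (s j).2.2) := by rw [← hv]
      have hcol : maxColor c s j k =
          max (maxColor c s (j + 1) (i₀ + 1)) (maxColor c s (i₀ + 1) k) := by
        rw [maxColor_trans (Nat.le_succ j) hjk, maxColor_succ,
          maxColor_trans (show j + 1 ≤ i₀ + 1 by omega) hik]
        simp [pendingColor, hv]
      rw [hcol, hsj]
      exact .push _ b v _ _ _ _ _ e₁ e₂
    · have hlen : (s (j + 1)).1.length = (s j).1.length - 1 := by simp [hnext]
      obtain rfl : k = j + 1 := by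
        by_contra hne
        have := hlow (j + 1) (by omega) (by omega)
        omega
      refine ⟨?_, by rw [hnext]⟩
      have hsj : (s j).2 = ([], r.src) := Prod.ext hv hsrc.symm
      rw [maxColor_succ, pendingColor, if_pos hv, ← hsrc, hsj, hnext]
      exact .pop _ r hp hpop

end

section

variable {d L : ℕ} {Live : List A × P → Prop} {M : List A × P → Sig d}
  {rep : List A → List A} {s : ℕ → List A × List A × P}

/-- The configuration in the original game represented by one of the folded game. -/
def refold (rep : List A → List A) (x : List A × List A × P) : List A × P :=
  glue (foldRep rep x.1) x.2

theorem progress_of_segment (hL : ∀ r ∈ Δ, r.push.length ≤ L) (hd : ∀ p, c p ≤ d)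
    (hM : IsMeasured c t Live M) (hrep : ∀ u, Simulates c t Live M L (rep u) u) {j k : ℕ}
    (hs : ∀ i, j ≤ i → i < k → PendingStep (fun w => t (foldRep rep w)) (s i) (s (i + 1)))
    (hjk : j ≤ k) (hlow : ∀ i, j ≤ i → i ≤ k → (s j).1.length ≤ (s i).1.length)
    (hj : (s j).2.1.length ≤ L) (hl : Live (refold rep (s j))) :
    (s k).2.1.length ≤ L ∧ Live (refold rep (s k)) ∧
      Sig.Progress (maxColor c s j k) (M (refold rep (s k))) (M (refold rep (s j))) := by
  induction k using Nat.strong_induction_on with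
  | _ k ih =>
    rcases hjk.eq_or_lt with rfl | hlt
    · exact ⟨hj, hl, by simpa [maxColor] using Sig.progress_zero le_rfl⟩
    obtain ⟨k, rfl⟩ : ∃ k', k = k' + 1 := ⟨k - 1, by omega⟩
    have ih' : ∀ i, j ≤ i → i < k + 1 → _ := fun i h1 h2 =>
      ih i h2 (fun i' h3 h4 => hs i' h3 (by omega)) h1 fun i' h3 h4 => hlow i' h3 (by omega)
    rcases hs k (by omega) (by omega) with ⟨b, v, hv, hnext⟩ | ⟨hv, r, hp, hsrc, hpop, hnext⟩
    · obtain ⟨h1, h2, h3⟩ := ih' k (by omega) (by omega)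
      have hvL : v.length ≤ L := by
        rw [hv, List.length_cons] at h1
        omega
      have hg : refold rep (s k) = glue (foldRep rep (s k).1 ++ [b]) (v, (s k).2.2) := by
        simp [refold, glue, hv]
      have hg' : refold rep (s (k + 1)) =
          glue (rep (foldRep rep (s k).1 ++ [b])) (v, (s k).2.2) := by
        simp [refold, hnext]
      rw [hg] at h2 h3
      rw [hg', maxColor_trans (show j ≤ k by omega) (Nat.le_succ k), maxColor_succ, pendingColor,
        if_neg (by simp [hv]), max_eq_left (Nat.zero_le _)]
      exact ⟨by rw [hnext]; exact hvL, (hrep _).live hvL h2, h3.of_le ((hrep _).measure_le hvL)⟩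
    · have hpL : (s (k + 1)).2.1.length ≤ L := by rw [hnext]; exact hL r hp.1
      refine ⟨hpL, ?_⟩
      have hlen : (s (k + 1)).1.length = (s k).1.length - 1 := by simp [hnext]
      rcases (Nat.eq_zero_or_pos (s k).1.length) with h0 | hpos
      · obtain ⟨h1, h2, h3⟩ := ih' k (by omega) (by omega)
        have hw : (s k).1 = [] := List.length_eq_zero_iff.1 h0
        have hw' : (s (k + 1)).1 = [] := by simp [hnext, hw]
        have he : Exit c t [] (s k).2 (pendingColor c (s k)) (s (k + 1)).2 := by
          have hsk : (s k).2 = ([], r.src) := Prod.ext hv hsrc.symm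
          rw [pendingColor, if_pos hv, ← hsrc, hsk, hnext]
          exact .pop _ r (by simpa [hw] using hp) (by rw [hpop, hw])
        have hg : refold rep (s k) = glue [] (s k).2 := by simp [refold, hw]
        have hg' : refold rep (s (k + 1)) = glue [] (s (k + 1)).2 := by simp [refold, hw']
        rw [hg] at h2 h3
        obtain ⟨h4, h5⟩ := he.progress hM h2
        rw [hg', maxColor_trans (show j ≤ k by omega) (Nat.le_succ k), maxColor_succ]
        exact ⟨h4, h3.comp h5⟩
      · classical
        obtain ⟨i, hi⟩ : ∃ i, i = Nat.findGreatest
          (fun i => j ≤ i ∧ (s i).1.length ≤ (s (k + 1)).1.length) k := ⟨_, rfl⟩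
        have hjP : j ≤ j ∧ (s j).1.length ≤ (s (k + 1)).1.length :=
          ⟨le_rfl, hlow _ (by omega) le_rfl⟩
        have hspec := Nat.findGreatest_spec
          (P := fun i => j ≤ i ∧ (s i).1.length ≤ (s (k + 1)).1.length) (show j ≤ k by omega) hjP
        have hik := Nat.findGreatest_le
          (P := fun i => j ≤ i ∧ (s i).1.length ≤ (s (k + 1)).1.length) k
        have hgr : ∀ i', _ := fun i' => Nat.findGreatest_is_greatest
          (P := fun i => j ≤ i ∧ (s i).1.length ≤ (s (k + 1)).1.length) (n := k) (k := i')
        rw [← hi] at hspec hik hgr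
        have hne : i ≠ k := by rintro rfl; omega
        have habove : ∀ i', i + 1 ≤ i' → i' < k + 1 →
            (s (k + 1)).1.length < (s i').1.length := fun i' h1 h2 => by
          have := hgr i' (by omega) (by omega)
          omega
        have hi1 := habove (i + 1) le_rfl (by omega)
        obtain ⟨h1, h2, h3⟩ := ih' i hspec.1 (by omega)
        rcases hs i hspec.1 (by omega) with ⟨b, v, hv, hup⟩ | ⟨-, r', -, -, -, hdown⟩
        swap
        · have : (s (i + 1)).1.length = (s i).1.length - 1 := by simp [hdown]
          omega
        have hup' : (s (i + 1)).1.length = (s i).1.length + 1 := by simp [hup]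
        obtain ⟨he, hw⟩ := exit_of_segment (c := c) (fun i' h1 h2 => hs i' (by omega) h2)
          (show i + 1 < k + 1 by omega) (by omega) habove
        have hvL : v.length ≤ L := by
          rw [hv, List.length_cons] at h1
          omega
        have hw' : (s (k + 1)).1 = (s i).1 := by simp [hw, hup]
        rw [hup] at he
        have he' := he.of_foldRep hL hd hrep hvL
        rw [foldRep_concat] at he'
        have he'' := (hrep _).exit hvL he'
        have hg : refold rep (s i) = glue (foldRep rep (s i).1 ++ [b]) (v, (s i).2.2) := by
          simp [refold, glue, hv]
        have hg' : refold rep (s (k + 1)) = glue (foldRep rep (s i).1) (s (k + 1)).2 := by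
          simp [refold, hw']
        rw [hg] at h2 h3
        have h4 := he''.progress hM h2
        rw [List.dropLast_concat] at h4
        have hcol : maxColor c s j (k + 1) =
            max (maxColor c s j i) (maxColor c s (i + 1) (k + 1)) := by
          rw [maxColor_trans hspec.1 (show i ≤ k + 1 by omega),
            maxColor_trans (Nat.le_succ i) (show i + 1 ≤ k + 1 by omega), maxColor_succ]
          simp [pendingColor, hv]
        rw [hg', hcol]
        exact ⟨h4.1, h3.comp h4.2⟩

end
section

variable {d L : ℕ} {Live : List A × P → Prop} {M : List A × P → Sig d}
  {rep : List A → List A} {s : ℕ → List A × List A × P} {v₀ : List A × P}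

theorem not_odd_recurrent_pendingColor (hL : ∀ r ∈ Δ, r.push.length ≤ L) (hd : ∀ p, c p ≤ d)
    (hM : IsMeasured c t Live M) (hrep : ∀ u, Simulates c t Live M L (rep u) u)
    (hs : ∀ i, PendingStep (fun w => t (foldRep rep w)) (s i) (s (i + 1)))
    (h₀ : s 0 = ([], v₀)) (hv₀ : v₀.1.length ≤ L) (hl : Live v₀) {m N : ℕ} (hm : Odd m)
    (hle : ∀ k ≥ N, pendingColor c (s k) ≤ m) : ¬ ∀ n, ∃ k ≥ n, pendingColor c (s k) = m := by
  intro hio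
  have hrec : ∀ n, ∃ i, n ≤ i ∧ (∀ k ≥ i, (s i).1.length ≤ (s k).1.length) ∧
      ∃ k, n ≤ k ∧ k < i ∧ pendingColor c (s k) = m := fun n => by
    obtain ⟨k, hk, hkm⟩ := hio n
    have hne : (Set.Ioi k).Nonempty := ⟨k + 1, Nat.lt_succ_self k⟩
    have hmem := Function.argminOn_mem (fun i => (s i).1.length) (Set.Ioi k) hne
    rw [Set.mem_Ioi] at hmem
    refine ⟨_, hk.trans hmem.le, fun k' hk' => ?_, k, hk, hmem, hkm⟩
    exact Function.argminOn_le (fun i => (s i).1.length) (Set.Ioi k)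
      (Set.mem_Ioi.2 (hmem.trans_le hk'))
  choose next hnext using hrec
  let a : ℕ → ℕ := fun n => next^[n + 1] N
  have ha : ∀ n, a (n + 1) = next (a n) := fun n => Function.iterate_succ_apply' next (n + 1) N
  have hrecord : ∀ n, N ≤ a n ∧ ∀ k ≥ a n, (s (a n)).1.length ≤ (s k).1.length := fun n => by
    induction n with
    | zero => exact ⟨(hnext N).1, (hnext N).2.1⟩
    | succ n ih =>
      rw [ha]
      exact ⟨ih.1.trans (hnext _).1, (hnext _).2.1⟩
  have hlive : ∀ n, _ := fun n => progress_of_segment (k := a n) hL hd hM hrep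
    (fun i _ _ => hs i) (Nat.zero_le _) (fun i _ _ => by simp [h₀]) (by rw [h₀]; exact hv₀)
    (by rw [h₀]; simpa [refold, glue] using hl)
  refine Sig.not_progress_chain hm (fun n => M (refold rep (s (a n)))) fun n => ?_
  obtain ⟨h1, -, k, h2, h3, h4⟩ := hnext (a n)
  rw [← ha] at h1 h3
  obtain ⟨-, -, h5⟩ := progress_of_segment hL hd hM hrep (fun i _ _ => hs i) h1
    (fun i hi _ => (hrecord n).2 i hi) (hlive n).1 (hlive n).2.1
  have hcol : maxColor c s (a n) (a (n + 1)) = m := by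
    refine le_antisymm (Finset.sup_le fun i hi => ?_) ?_
    · exact hle i ((hrecord n).1.trans (Finset.mem_Ico.1 hi).1)
    · exact h4 ▸ Finset.le_sup (f := fun i => pendingColor c (s i)) (Finset.mem_Ico.2 ⟨h2, h3⟩)
  rwa [hcol] at h5

theorem exists_seq_of_reflTransGen {X : Type*} {R : X → X → Prop} {x y : X}
    (h : Relation.ReflTransGen R x y) :
    ∃ (s : ℕ → X) (n : ℕ), s 0 = x ∧ s n = y ∧ ∀ i < n, R (s i) (s (i + 1)) := by
  induction h with
  | refl => exact ⟨fun _ => x, 0, rfl, rfl, fun i hi => absurd hi (Nat.not_lt_zero i)⟩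
  | @tail y z _ hyz ih =>
    obtain ⟨s, n, h0, hn, hs⟩ := ih
    refine ⟨fun i => if i ≤ n then s i else z, n + 1, by simpa using h0, by simp, fun i hi => ?_⟩
    rcases (Nat.lt_succ_iff.1 hi).lt_or_eq with hlt | rfl
    · simpa [hlt.le, Nat.succ_le_of_lt hlt] using hs i hlt
    · simpa [hn] using hyz

theorem live_of_reflTransGen (hL : ∀ r ∈ Δ, r.push.length ≤ L) (hd : ∀ p, c p ≤ d)
    (hM : IsMeasured c t Live M) (hrep : ∀ u, Simulates c t Live M L (rep u) u)
    (hv₀ : v₀.1.length ≤ L) (hl : Live v₀) {x : List A × List A × P}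
    (hx : Relation.ReflTransGen (PendingStep fun w => t (foldRep rep w)) ([], v₀) x) :
    Live (refold rep x) := by
  obtain ⟨s, n, h₀, rfl, hs⟩ := exists_seq_of_reflTransGen hx
  exact (progress_of_segment hL hd hM hrep (fun i _ hi => hs i hi) (Nat.zero_le n)
    (fun i _ _ => by simp [h₀]) (by rw [h₀]; exact hv₀)
    (by rw [h₀]; simpa [refold, glue] using hl)).2.1

end

theorem reflTransGen_glue (w v : List A) (q : P) :
    Relation.ReflTransGen (PendingStep t) (w, v, q) (w ++ v, [], q) := by
  induction v generalizing w with
  | nil => simpa using Relation.ReflTransGen.refl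
  | cons b v ih =>
    have := ih (w ++ [b])
    rw [List.append_assoc, List.singleton_append] at this
    exact .head (.inl ⟨b, v, rfl, rfl⟩) this

theorem reflTransGen_ruleStep {r : PDRule A P} {v v' : List A × P} (hp : Permitted (t v.1) r)
    (hr : RuleStep r v v') :
    Relation.ReflTransGen (PendingStep t) (v.1, [], v.2) (v'.1, [], v'.2) := by
  rw [ruleStep_iff] at hr
  rw [hr.2.2.2, ← hr.2.1]
  exact .head (.inr ⟨rfl, r, hp, hr.1, hr.2.2.1, rfl⟩) (reflTransGen_glue _ _ _)

/-- A play of the pushdown game, spelled out as a play with pending part. -/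
theorem exists_pending_play {π : ℕ → List A × P} {r : ℕ → PDRule A P}
    (hp : ∀ n, Permitted (t (π n).1) (r n)) (hr : ∀ n, RuleStep (r n) (π n) (π (n + 1))) :
    ∃ (s : ℕ → List A × List A × P) (idx : ℕ → ℕ), s 0 = ([], π 0) ∧
      (∀ i, PendingStep t (s i) (s (i + 1))) ∧ Monotone idx ∧
      (∀ k, (s k).2.1 = [] → (s k).2.2 = (π (idx k)).2) ∧
      ∀ n, ∃ k, idx k = n ∧ (s k).2.1 = [] := by
  let step : ℕ × List A × List A × P → ℕ × List A × List A × P := fun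
    | (n, w, b :: v, q) => (n, w ++ [b], v, q)
    | (n, w, [], _) => (n + 1, w.dropLast, (r n).push, (r n).dst)
  let e : ℕ → ℕ × List A × List A × P := fun k => step^[k] (0, [], π 0)
  have he : ∀ k, e (k + 1) = step (e k) := fun k => Function.iterate_succ_apply' step k _
  have hinv : ∀ k, glue (e k).2.1 (e k).2.2 = π (e k).1 := fun k => by
    induction k with
    | zero => simp [e, glue]
    | succ k ih =>
      rw [he]
      generalize e k = x at ih
      obtain ⟨n, w, v, q⟩ := x
      cases v with
      | cons b v => simpa [step, glue] using ih
      | nil =>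
        have := ruleStep_iff.1 (hr n)
        simp only [glue, List.append_nil] at ih
        rw [← ih] at this
        exact Prod.ext this.2.2.2.symm this.2.1
  have hdone : ∀ k, (e k).2.2.1 = [] → (e k).2.1 = (π (e k).1).1 ∧ (e k).2.2.2 = (π (e k).1).2 :=
    fun k hk => by
      rw [← hinv k]
      simp [glue, hk]
  have hend : ∀ l k, (e k).2.2.1.length = l → ∃ k', (e k').1 = (e k).1 ∧ (e k').2.2.1 = [] := by
    intro l
    induction l with
    | zero => exact fun k hk => ⟨k, rfl, List.length_eq_zero_iff.1 hk⟩
    | succ l ih =>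
      intro k hk
      obtain ⟨b, v, hv⟩ := List.exists_cons_of_length_eq_add_one hk
      have hnext : (e (k + 1)).1 = (e k).1 ∧ (e (k + 1)).2.2.1 = v := by
        rw [he]
        generalize e k = x at hv
        obtain ⟨n, w, v', q⟩ := x
        obtain rfl : v' = b :: v := hv
        exact ⟨rfl, rfl⟩
      obtain ⟨k', h1, h2⟩ := ih (k + 1) (by rw [hnext.2]; simpa [hv] using hk)
      exact ⟨k', h1.trans hnext.1, h2⟩
  refine ⟨fun k => (e k).2, fun k => (e k).1, rfl, fun k => ?_, ?_, fun k hk => (hdone k hk).2,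
    fun n => ?_⟩
  · have hk := hdone k
    dsimp only
    rw [he]
    generalize e k = x at hk
    obtain ⟨n, w, v, q⟩ := x
    cases v with
    | cons b v => exact .inl ⟨b, v, rfl, rfl⟩
    | nil =>
      obtain ⟨h1, h2⟩ := hk rfl
      have := ruleStep_iff.1 (hr n)
      dsimp only at h1 h2
      rw [h1, h2]
      exact .inr ⟨rfl, r n, hp n, this.1, this.2.2.1, rfl⟩
  · refine monotone_nat_of_le_succ fun k => ?_
    rw [he]
    obtain ⟨n, w, v, q⟩ := e k
    cases v <;> simp [step]
  · induction n with
    | zero =>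
      obtain ⟨k, h1, h2⟩ := hend _ 0 rfl
      exact ⟨k, h1, h2⟩
    | succ n ih =>
      obtain ⟨k, h1, h2⟩ := ih
      obtain ⟨k', h3, h4⟩ := hend _ (k + 1) rfl
      refine ⟨k', ?_, h4⟩
      dsimp only at h1 h2 ⊢
      rw [h3, he]
      generalize e k = x at h1 h2
      obtain ⟨n', w, v, q⟩ := x
      obtain rfl : v = [] := h2
      exact congrArg (· + 1) h1

end Pushdown

/-! ### Memoryless strategies -/

theorem ConsHist.reach {V : Type} {G : GameGraph V} {p : Player} {f : V → V} {u₀ : V} {l : List V}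
    (h : ConsHist G p (liftMemoryless f u₀) u₀ l) :
    ∀ v, l.getLast? = some v → Reach G p f u₀ v := by
  induction h with
  | init =>
    rintro v hv
    obtain rfl : u₀ = v := by simpa using hv
    exact .base
  | ownStep l u _ hu ho ih =>
    rintro v hv
    obtain rfl : liftMemoryless f u₀ l = v := by simpa using hv
    simpa [liftMemoryless, hu] using Reach.ownStep (ih u hu) ho
  | oppStep l u w _ hu ho hE ih =>
    rintro v hv
    obtain rfl : w = v := by simpa using hv
    exact .oppStep (ih u hu) ho hE

theorem liftMemoryless_hist {V : Type} (f : V → V) (u₀ : V) (π : ℕ → V) (n : ℕ) :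
    liftMemoryless f u₀ (hist π n) = f (π n) := by
  simp only [liftMemoryless, hist, List.ofFn_succ', List.concat_eq_append, List.getLast?_concat]
  rfl

/-- If Player II has a winning strategy from `v₀` in a pushdown parity game, then some
regular instruction tree determines a memoryless winning strategy for Player II from `v₀`. -/
theorem statement5 {A P : Type} [Finite A] [Finite P]
    (pOwner : P → Player) (Δ : Finset (PDRule A P)) (c : P → ℕ)
    (htot : ∀ v, ∃ w, (pushdownGame pOwner Δ c).E v w)
    (v₀ : List A × P)
    (h : ∃ σ, WinningStrategyFrom (pushdownGame pOwner Δ c) Player.two σ v₀) :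
    ∃ t : List A → ({p : P // pOwner p = Player.two} → {r : PDRule A P // r ∈ Δ}),
      RegularFun t ∧
      ∃ f : List A × P → List A × P,
        MemorylessWinningFrom (pushdownGame pOwner Δ c) Player.two f v₀ ∧
        Determines pOwner Δ c Player.two t f v₀ := by
  classical
  obtain ⟨σ, hσ⟩ := h
  obtain ⟨d, hd⟩ : ∃ d, ∀ p, c p ≤ d := by
    obtain ⟨d, hd⟩ := (Set.finite_range c).bddAbove
    exact ⟨d, fun p => hd ⟨p, rfl⟩⟩
  let L := max (Δ.sup fun r => r.push.length) v₀.1.length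
  have hL : ∀ r ∈ Δ, r.push.length ≤ L := fun r hr =>
    (Finset.le_sup (f := fun r : PDRule A P => r.push.length) hr).trans (le_max_left _ _)
  obtain ⟨t, Live, M, hl, hM⟩ := exists_isMeasured hd htot hσ
  obtain ⟨rep, hfin, hrep⟩ := exists_simulates (c := c) (t := t) hL hd Live M
  let t' := fun w => t (foldRep rep w)
  let f : List A × P → List A × P := fun v =>
    if h : ∃ v', ∃ ho : pOwner v.2 = .two, RuleStep (t' v.1 ⟨v.2, ho⟩).val v v' then h.choose else v
  let R : List A × P → Prop := fun v =>
    Relation.ReflTransGen (PendingStep t') ([], v₀) (v.1, [], v.2)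
  have hown : ∀ v, R v → ∀ ho : pOwner v.2 = .two, RuleStep (t' v.1 ⟨v.2, ho⟩).val v (f v) := by
    intro v hv ho
    have hlive := live_of_reflTransGen hL hd hM hrep (le_max_right _ _) hl hv
    simp only [refold, glue, List.append_nil] at hlive
    obtain ⟨v', hv'⟩ := (hM _ hlive).1 ho
    rw [ruleStep_iff] at hv'
    have hex : ∃ v', ∃ ho : pOwner v.2 = .two, RuleStep (t' v.1 ⟨v.2, ho⟩).val v v' := by
      refine ⟨(_, _), ho, ruleStep_iff.2 ⟨hv'.1, rfl, ?_, rfl⟩⟩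
      exact hv'.2.2.1.trans (getLast?_foldRep hrep _)
    simp only [f, dif_pos hex]
    exact hex.choose_spec.choose_spec
  have hperm : ∀ v v', R v → (pushdownGame pOwner Δ c).E v v' →
      (pOwner v.2 = .two → v' = f v) → ∃ r, Permitted (t' v.1) r ∧ RuleStep r v v' := by
    rintro v v' hv ⟨r, hr, hs⟩ hf
    by_cases ho : pOwner v.2 = .two
    · refine ⟨_, ⟨(t' v.1 ⟨v.2, ho⟩).2, fun h => ?_⟩, hf ho ▸ hown v hv ho⟩
      have hsrc := (hown v hv ho).1
      simp only [hsrc]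
    · exact ⟨r, ⟨hr, fun h => absurd (hs.1 ▸ h) ho⟩, hs⟩
  have hE : ∀ v, R v → pOwner v.2 = .two → (pushdownGame pOwner Δ c).E v (f v) :=
    fun v hv ho => ⟨_, Subtype.prop _, hown v hv ho⟩
  have hstep : ∀ v v', R v → (pushdownGame pOwner Δ c).E v v' →
      (pOwner v.2 = .two → v' = f v) → R v' := fun v v' hv hvE hf => by
    obtain ⟨r, hp, hr⟩ := hperm v v' hv hvE hf
    exact hv.trans (reflTransGen_ruleStep hp hr)
  have hreach : ∀ v, Reach (pushdownGame pOwner Δ c) .two f v₀ v → R v := fun v hv => by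
    induction hv with
    | base => exact reflTransGen_glue [] v₀.1 v₀.2
    | ownStep _ ho ih => exact hstep _ _ ih (hE _ ih ho) fun _ => rfl
    | oppStep _ ho hvE ih => exact hstep _ _ ih hvE fun h => absurd h ho
  refine ⟨t', regularFun_comp_foldRep hfin t, f, ⟨fun l v hc hlast ho => ?_, fun π hπ hcons => ?_⟩,
    fun v hv ho => hown v (hreach v hv) ho⟩
  · simpa [liftMemoryless, hlast] using hE v (hreach v (hc.reach v hlast)) ho
  · have hf : ∀ n, pOwner (π n).2 = .two → π (n + 1) = f (π n) := fun n ho =>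
      (hcons n ho).trans (liftMemoryless_hist f v₀ π n)
    have hR : ∀ n, R (π n) := fun n => by
      induction n with
      | zero => exact hπ.1 ▸ hreach v₀ .base
      | succ n ih => exact hstep _ _ ih (hπ.2 n) (hf n)
    choose r hp hr using fun n => hperm (π n) (π (n + 1)) (hR n) (hπ.2 n) (hf n)
    obtain ⟨s, idx, h₀, hs, hmono, hcol, hidx⟩ := exists_pending_play hp hr
    by_contra hwon
    obtain ⟨m, hm, ⟨N, hN⟩, hio⟩ :=
      exists_odd_of_not_maxInfEven (s := fun n => c (π n).2) (fun n => hd _) hwon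
    obtain ⟨K, hK, -⟩ := hidx N
    refine not_odd_recurrent_pendingColor (N := K) hL hd hM hrep hs (hπ.1 ▸ h₀) (le_max_right _ _)
      hl hm (fun k hk => ?_) fun n => ?_
    · unfold pendingColor
      split_ifs with hk'
      · rw [hcol k hk']
        exact hN _ (hK ▸ hmono hk)
      · exact Nat.zero_le m
    · obtain ⟨n', hn', hm'⟩ := hio (idx n + 1)
      obtain ⟨k, rfl, hk⟩ := hidx n'
      refine ⟨k, (hmono.reflect_lt (Nat.lt_of_succ_le hn')).le, ?_⟩
      rw [pendingColor, if_pos hk, hcol k hk]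
      exact hm'
end

section
/- Let (P_I, P_II, Δ, c) be a pushdown parity game system over a finite alphabet 𝔸, inducing the pushdown parity game graph H, and let v₀ be a vertex of H. If Player I has a winning strategy from v₀ in the parity game over H, then there is a regular function f : 𝔸* → 𝕀₁ that determines a memoryless winning strategy for Player I from v₀ in the parity game over H. -/
namespace PushdownParity
open Filter Relation

/-- `m` is the greatest value taken infinitely often by `s`, and no larger value recurs. -/
def Top (s : ℕ → ℕ) (m : ℕ) : Prop :=
  (∃ᶠ n in atTop, s n = m) ∧ ∀ᶠ n in atTop, s n ≤ m

theorem Top.maxInfEven {s : ℕ → ℕ} {m : ℕ} (h : Top s m) (hm : Even m) : MaxInfEven s := by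
  refine ⟨m, hm, Nat.frequently_atTop_iff_infinite.1 h.1, fun m' h' => ?_⟩
  obtain ⟨n, hn, hn'⟩ := ((Nat.frequently_atTop_iff_infinite.2 h').and_eventually h.2).exists
  exact hn ▸ hn'

theorem exists_top_of_maxInfEven {s : ℕ → ℕ} {d : ℕ} (hd : ∀ n, s n ≤ d) (h : MaxInfEven s) :
    ∃ m, Even m ∧ Top s m := by
  obtain ⟨m, hm, hi, hmax⟩ := h
  refine ⟨m, hm, Nat.frequently_atTop_iff_infinite.2 hi, ?_⟩
  have : ∀ᶠ n in atTop, ∀ k ∈ Finset.Icc (m + 1) d, s n ≠ k := by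
    refine (Finset.eventually_all _).2 fun k hk => ?_
    by_contra hc
    have := hmax k (Nat.frequently_atTop_iff_infinite.1 (by simpa [Filter.Frequently] using hc))
    simp at hk
    omega
  filter_upwards [this] with n hn
  by_contra hc
  exact hn (s n) (by simp; exact ⟨by omega, hd n⟩) rfl

theorem Top.of_succ {s : ℕ → ℕ} {m : ℕ} (h : Top (fun n => s (n + 1)) m) : Top s m := by
  refine ⟨?_, ?_⟩
  · rw [frequently_atTop]
    intro a
    obtain ⟨b, hb, hb'⟩ := frequently_atTop.1 h.1 a
    exact ⟨b + 1, by omega, hb'⟩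
  · obtain ⟨a, ha⟩ := eventually_atTop.1 h.2
    refine eventually_atTop.2 ⟨a + 1, fun b hb => ?_⟩
    have := ha (b - 1) (by omega)
    simpa [Nat.sub_add_cancel (by omega : 1 ≤ b)] using this

/-- An eventually antitone sequence in a well-founded order is eventually constant. -/
theorem eventually_const_of_antitone {α : Type*} [PartialOrder α] [WellFoundedLT α] (s : ℕ → α)
    (N : ℕ) (h : ∀ n ≥ N, s (n + 1) ≤ s n) : ∃ M ≥ N, ∀ n ≥ M, s n = s M := by
  have anti : ∀ m ≥ N, ∀ n ≥ m, s n ≤ s m := by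
    intro m hm n hn
    induction n, hn using Nat.le_induction with
    | base => rfl
    | succ n hn ih => exact (h n (by omega)).trans ih
  obtain ⟨x, ⟨M, hM, rfl⟩, hmin⟩ :=
    (wellFounded_lt (α := α)).has_min {x | ∃ n ≥ N, s n = x} ⟨s N, N, le_rfl, rfl⟩
  exact ⟨M, hM, fun n hn =>
    (anti M hM n hn).eq_of_not_lt (hmin _ ⟨n, by omega, rfl⟩)⟩

/-- No infinite path from `z` has an even recurring maximal color. -/
def Good {V : Type*} (S : V → V → Prop) (col : V → ℕ) (z : V) : Prop :=
  ∀ π : ℕ → V, π 0 = z → (∀ n, S (π n) (π (n + 1))) →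
    ∀ k, Even k → ¬ Top (fun n => col (π n)) k

theorem Good.step {V : Type*} {S : V → V → Prop} {col : V → ℕ} {z z' : V} (h : Good S col z)
    (hs : S z z') : Good S col z' := by
  intro π h0 hπ k hk ht
  refine h (fun n => Nat.casesOn n z π) rfl ?_ k hk (Top.of_succ (s := fun n => _) ht)
  rintro (_ | n)
  · simpa [h0] using hs
  · exact hπ n

section Rank

variable {V : Type*} (S : V → V → Prop) (col : V → ℕ) (k : ℕ)

/-- `Below z' z`: there is a path from the good vertex `z` to `z'` with colors at most `k`
whose last step leaves a vertex of color `k`. -/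
def Below (z' z : V) : Prop :=
  Good S col z ∧ ∃ y, ReflTransGen (fun a b => col a ≤ k ∧ S a b) z y ∧ col y = k ∧ S y z'

/-- `Dist R n y`: after `n` steps through colors at most `k`, followed by a step leaving a vertex
of color `k`, one reaches a vertex in `R`. -/
def Dist (R : V → Prop) : ℕ → V → Prop
  | 0, y => col y = k ∧ ∃ z', S y z' ∧ R z'
  | n + 1, y => col y ≤ k ∧ ∃ y', S y y' ∧ Dist R n y'

variable {S col k}

theorem exists_dist {R : V → Prop} {z : V}
    (h : ∃ y, ReflTransGen (fun a b => col a ≤ k ∧ S a b) z y ∧ col y = k ∧ ∃ z', S y z' ∧ R z') :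
    ∃ n, Dist S col k R n z := by
  obtain ⟨y, hzy, hy⟩ := h
  induction hzy using ReflTransGen.head_induction_on with
  | refl => exact ⟨0, hy⟩
  | head hs _ ih => exact ⟨ih.choose + 1, hs.1, _, hs.2, ih.choose_spec⟩

theorem wellFounded_below (hk : Even k) : WellFounded (Below S col k) := by
  refine ⟨fun z => ?_⟩
  by_contra hz
  set R : V → Prop := fun z => ¬ Acc (Below S col k) z with hR
  have hnext : ∀ z, R z → Good S col z ∧ ∃ n, Dist S col k R n z := by
    intro z hz
    obtain ⟨z', hz', hg, y, h1, h2, h3⟩ := exists_not_acc_lt_of_not_acc hz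
    exact ⟨hg, exists_dist ⟨y, h1, h2, z', h3, hz'⟩⟩
  have hD : ∀ p : {p : ℕ × V // Dist S col k R p.1 p.2}, ∃ q : {p : ℕ × V // Dist S col k R p.1 p.2},
      S p.1.2 q.1.2 ∧ col p.1.2 ≤ k ∧ ((p.1.1 = 0 ∧ col p.1.2 = k) ∨ p.1.1 = q.1.1 + 1) := by
    rintro ⟨⟨n, y⟩, hp⟩
    cases n with
    | zero =>
      obtain ⟨hc, z', hs, hz'⟩ := hp
      obtain ⟨-, n, hn⟩ := hnext z' hz'
      exact ⟨⟨(n, z'), hn⟩, hs, hc.le, .inl ⟨rfl, hc⟩⟩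
    | succ n =>
      obtain ⟨hc, y', hs, hy'⟩ := hp
      exact ⟨⟨(n, y'), hy'⟩, hs, hc, .inr rfl⟩
  choose nx hnx using hD
  obtain ⟨hg, n, hn⟩ := hnext z hz
  let path : ℕ → {p : ℕ × V // Dist S col k R p.1 p.2} := fun i => nx^[i] ⟨(n, z), hn⟩
  have hp : ∀ i, path (i + 1) = nx (path i) := fun i => Function.iterate_succ_apply' _ _ _
  refine hg (fun i => (path i).1.2) rfl (fun i => ?_) k hk ⟨?_, .of_forall fun i => (hnx (path i)).2.1⟩
  · rw [hp]; exact (hnx (path i)).1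
  · rw [frequently_atTop]
    intro a
    suffices ∀ m a, (path a).1.1 = m → ∃ b ≥ a, col (path b).1.2 = k from this _ a rfl
    intro m
    induction m with
    | zero =>
      intro a ha
      rcases (hnx (path a)).2.2 with h | h
      · exact ⟨a, le_rfl, h.2⟩
      · omega
    | succ m ih =>
      intro a ha
      rcases (hnx (path a)).2.2 with h | h
      · omega
      · obtain ⟨b, hb, hb'⟩ := ih (a + 1) (by rw [hp]; omega)
        exact ⟨b, by omega, hb'⟩

end Rank

/-- Progress measure for a single even color on the good part of a graph. -/
theorem exists_rank {V : Type} (S : V → V → Prop) (col : V → ℕ) (k : ℕ) (hk : Even k) :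
    ∃ ρ : V → Ordinal.{0}, ∀ z z', Good S col z → S z z' → col z ≤ k →
      ρ z' ≤ ρ z ∧ (col z = k → ρ z' < ρ z) := by
  have : IsWellFounded V (Below S col k) := ⟨wellFounded_below hk⟩
  refine ⟨IsWellFounded.rank (Below S col k), fun z z' hg hs hc => ⟨?_, fun h => ?_⟩⟩
  · rw [IsWellFounded.rank_eq (Below S col k) z']
    refine Ordinal.iSup_le fun ⟨y, hy⟩ => Order.succ_le_of_lt ?_
    refine IsWellFounded.rank_lt_of_rel ?_
    obtain ⟨-, x, h1, h2⟩ := hy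
    exact ⟨hg, x, .head ⟨hc, hs⟩ h1, h2⟩
  · exact IsWellFounded.rank_lt_of_rel ⟨hg, z, .refl, h, hs⟩

/-- Keep the entries of index less than `e`, and replace the others by `0`. -/
def trunc {N : ℕ} (e : ℕ) (a : Fin N → Ordinal.{0}) : Lex (Fin N → Ordinal.{0}) :=
  toLex fun i => if i.1 < e then a i else 0

theorem trunc_mono {N : ℕ} (e : ℕ) {a b : Fin N → Ordinal.{0}} (h : toLex a ≤ toLex b) :
    trunc e a ≤ trunc e b := by
  rcases h.eq_or_lt with h | ⟨i, hi, hlt⟩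
  · rw [toLex_inj.1 h]
  · by_cases hie : i.1 < e
    · refine le_of_lt ⟨i, fun j hj => ?_, ?_⟩
      · have := hi j hj
        simp only [trunc, Pi.toLex_apply] at this ⊢
        rw [this]
      · simpa [trunc, hie] using hlt
    · refine le_of_eq ?_
      unfold trunc
      congr 1
      funext j
      split_ifs with hj
      · exact hi j (show j.1 < i.1 by omega)
      · rfl

theorem trunc_le {N : ℕ} {e : ℕ} {a b : Fin N → Ordinal.{0}} (h : ∀ i, i.1 < e → a i ≤ b i) :
    trunc e a ≤ trunc e b := by
  refine Pi.toLex_monotone fun i => ?_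
  split_ifs with hi
  exacts [h i hi, le_rfl]

theorem trunc_lt {N : ℕ} {e : ℕ} {a b : Fin N → Ordinal.{0}} (h : ∀ i, i.1 < e → a i ≤ b i)
    (i : Fin N) (hi : i.1 < e) (hlt : a i < b i) : trunc e a < trunc e b := by
  refine Pi.toLex_strictMono (Pi.lt_def.2 ⟨fun j => ?_, i, by simpa [hi] using hlt⟩)
  dsimp only
  split_ifs with hj
  exacts [h j hj, le_rfl]

theorem trunc_eq_iff {N : ℕ} {e : ℕ} {a b : Fin N → Ordinal.{0}} (h : trunc e a = trunc e b)
    (i : Fin N) (hi : i.1 < e) : a i = b i := by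
  have := congrFun (toLex_inj.1 h) i
  simpa [hi] using this

section Positional

variable {V : Type} (G : GameGraph V)

/-- The moves of a play following the memoryless strategy `f` of Player I. -/
def FStep (f : V → V) (v w : V) : Prop :=
  (G.owner v = .one ∧ w = f v) ∨ (G.owner v ≠ .one ∧ G.E v w)

/-- The moves of a play following the strategy `σ` of Player I, on play prefixes. -/
def HStep (σ : List V → V) (l l' : List V) : Prop :=
  ∃ v w, l.getLast? = some v ∧ l' = l ++ [w] ∧
    ((G.owner v = .one ∧ w = σ l) ∨ (G.owner v ≠ .one ∧ G.E v w))

variable {G}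

theorem HStep.consHist {σ : List V → V} {u₀ : V} {l l' : List V} (hl : ConsHist G .one σ u₀ l)
    (h : HStep G σ l l') : ConsHist G .one σ u₀ l' := by
  obtain ⟨v, w, hv, rfl, ⟨ho, rfl⟩ | ⟨ho, hE⟩⟩ := h
  · exact .ownStep l v hl hv ho
  · exact .oppStep l v w hl hv ho hE

theorem hist_succ (π : ℕ → V) (n : ℕ) : hist π (n + 1) = hist π n ++ [π (n + 1)] := by
  rw [hist, List.ofFn_succ_last]
  simp [hist]

theorem hist_getLast? (π : ℕ → V) (n : ℕ) : (hist π n).getLast? = some (π n) := by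
  cases n with
  | zero => simp [hist]
  | succ n => simp [hist_succ]

theorem consHist_hist {σ : List V → V} {u₀ : V} {π : ℕ → V} (h0 : π 0 = u₀)
    (h : ∀ n, HStep G σ (hist π n) (hist π (n + 1))) (n : ℕ) :
    ConsHist G .one σ u₀ (hist π n) := by
  induction n with
  | zero => simpa [hist, h0] using ConsHist.init
  | succ n ih => exact (h n).consHist ih

theorem good_init {σ : List V → V} {u₀ : V} (h : WinningStrategyFrom G .one σ u₀) :
    Good (HStep G σ) (fun l => G.color (l.getLast?.getD u₀)) [u₀] := by
  intro L h0 hL k hk ht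
  set π : ℕ → V := fun n => (L n).getLast?.getD u₀ with hπ
  have hh : ∀ n, L n = hist π n := by
    intro n
    induction n with
    | zero => simp [hist, h0, hπ]
    | succ n ih =>
      rw [hist_succ, ← ih]
      obtain ⟨v, w, -, hw, -⟩ := hL n
      have : π (n + 1) = w := by simp [hπ, hw]
      rw [hw, this]
  have hstep : ∀ n, HStep G σ (hist π n) (hist π (n + 1)) := fun n => by
    rw [← hh, ← hh]; exact hL n
  have hmove : ∀ n, (G.owner (π n) = .one ∧ π (n + 1) = σ (hist π n)) ∨
      (G.owner (π n) ≠ .one ∧ G.E (π n) (π (n + 1))) := by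
    intro n
    obtain ⟨v, w, hv, hw, hvw⟩ := hstep n
    rw [hist_getLast?, Option.some_inj] at hv
    rw [hist_succ] at hw
    have : π (n + 1) = w := by simpa using hw
    rw [hv, this]
    exact hvw
  have hπ0 : π 0 = u₀ := by simp [hπ, h0]
  refine h.2 π ⟨hπ0, fun n => ?_⟩ (fun n hn => ?_) (ht.maxInfEven hk)
  · rcases hmove n with ⟨ho, he⟩ | ⟨_, he⟩
    · rw [he]
      exact h.1 _ _ (consHist_hist hπ0 hstep n) (hist_getLast? π n) ho
    · exact he
  · rcases hmove n with ⟨_, he⟩ | ⟨ho, _⟩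
    · exact he
    · exact absurd hn ho

theorem good_of_consHist {σ : List V → V} {u₀ : V} (h : WinningStrategyFrom G .one σ u₀)
    {l : List V} (hl : ConsHist G .one σ u₀ l) :
    Good (HStep G σ) (fun l => G.color (l.getLast?.getD u₀)) l := by
  induction hl with
  | init => exact good_init h
  | ownStep l v _ hv ho ih => exact ih.step ⟨v, _, hv, rfl, .inl ⟨ho, rfl⟩⟩
  | oppStep l v w _ hv ho hE ih => exact ih.step ⟨v, _, hv, rfl, .inr ⟨ho, hE⟩⟩

theorem exists_positional {d : ℕ} (hd : ∀ v, G.color v ≤ d) {σ : List V → V} {u₀ : V}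
    (h : WinningStrategyFrom G .one σ u₀) :
    ∃ (W : V → Prop) (f : V → V), W u₀ ∧ (∀ v w, W v → FStep G f v w → W w ∧ G.E v w) ∧
      ∀ v, W v → Good (FStep G f) G.color v := by
  have hρ : ∀ k, ∃ ρ : List V → Ordinal.{0}, ∀ l l', ConsHist G .one σ u₀ l → HStep G σ l l' →
      G.color (l.getLast?.getD u₀) ≤ k →
        ρ l' ≤ ρ l ∧ (Even k → G.color (l.getLast?.getD u₀) = k → ρ l' < ρ l) := by
    intro k
    by_cases hk : Even k
    · obtain ⟨ρ, hρ⟩ := exists_rank (HStep G σ) (fun l => G.color (l.getLast?.getD u₀)) k hk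
      exact ⟨ρ, fun l l' hl hs hc => (hρ l l' (good_of_consHist h hl) hs hc).imp_right fun h _ => h⟩
    · exact ⟨fun _ => 0, fun _ _ _ _ _ => ⟨le_rfl, fun h => absurd h hk⟩⟩
  choose ρ hρ using hρ
  let sig : List V → Fin (d + 1) → Ordinal.{0} := fun l i => ρ (d - i.1) l
  let W : V → Prop := fun v => ∃ l, ConsHist G .one σ u₀ l ∧ l.getLast? = some v
  have hmin : ∀ v, ∃ l, W v → (ConsHist G .one σ u₀ l ∧ l.getLast? = some v) ∧
      ∀ l', ConsHist G .one σ u₀ l' → l'.getLast? = some v → toLex (sig l) ≤ toLex (sig l') := by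
    intro v
    by_cases hv : W v
    · obtain ⟨l, hl, hm⟩ := (InvImage.wf (fun l => toLex (sig l))
        (wellFounded_lt (α := Lex (Fin (d + 1) → Ordinal.{0})))).has_min
        {l | ConsHist G .one σ u₀ l ∧ l.getLast? = some v} hv
      exact ⟨l, fun _ => ⟨hl, fun l' h1 h2 => not_lt.1 (hm l' ⟨h1, h2⟩)⟩⟩
    · exact ⟨[], fun h => absurd h hv⟩
  choose hh hhW using hmin
  let f : V → V := fun v => σ (hh v)
  have hstep : ∀ v w, W v → FStep G f v w → HStep G σ (hh v) (hh v ++ [w]) := fun v w hv hs =>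
    ⟨v, w, (hhW v hv).1.2, rfl, hs⟩
  have hWW : ∀ v w, W v → FStep G f v w → W w := fun v w hv hs =>
    ⟨_, (hstep v w hv hs).consHist (hhW v hv).1.1, by simp⟩
  refine ⟨W, f, ⟨[u₀], .init, rfl⟩, fun v w hv hs => ⟨hWW v w hv hs, ?_⟩, ?_⟩
  · rcases hs with ⟨ho, rfl⟩ | ⟨_, hE⟩
    · exact h.1 _ _ (hhW v hv).1.1 (hhW v hv).1.2 ho
    · exact hE
  · intro v hv π h0 hπ k hk ht
    have hWπ : ∀ n, W (π n) := by
      intro n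
      induction n with
      | zero => rwa [h0]
      | succ n ih => exact hWW _ _ ih (hπ n)
    have hkd : k ≤ d := by
      obtain ⟨n, hn⟩ := ht.1.exists
      exact hn ▸ hd _
    obtain ⟨T, hT⟩ := eventually_atTop.1 ht.2
    have key : ∀ n ≥ T, trunc (d - k + 1) (sig (hh (π (n + 1)))) ≤ trunc (d - k + 1) (sig (hh (π n)))
        ∧ (G.color (π n) = k →
          trunc (d - k + 1) (sig (hh (π (n + 1)))) < trunc (d - k + 1) (sig (hh (π n)))) := by
      intro n hn
      have hl := (hhW _ (hWπ n)).1
      have hs := hstep _ _ (hWπ n) (hπ n)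
      have h1 := trunc_mono (d - k + 1) ((hhW _ (hWπ (n + 1))).2 _ (hs.consHist hl.1) (by simp))
      have hcol : G.color ((hh (π n)).getLast?.getD u₀) = G.color (π n) := by rw [hl.2]; rfl
      have hle : ∀ i : Fin (d + 1), i.1 < d - k + 1 →
          sig (hh (π n) ++ [π (n + 1)]) i ≤ sig (hh (π n)) i := fun i hi =>
        (hρ (d - i.1) _ _ hl.1 hs (by rw [hcol]; have : G.color (π n) ≤ k := hT n hn; omega)).1
      refine ⟨h1.trans (trunc_le hle), fun hc => h1.trans_lt ?_⟩
      have hdk : d - (d - k) = k := by omega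
      refine trunc_lt hle ⟨d - k, by omega⟩ (by simp) ?_
      exact (hρ (d - (d - k)) _ _ hl.1 hs (by rw [hcol]; omega)).2 (by rwa [hdk])
        (by rw [hcol]; omega)
    obtain ⟨M, hM, hMc⟩ := eventually_const_of_antitone
      (fun n => trunc (d - k + 1) (sig (hh (π n)))) T fun n hn => (key n hn).1
    obtain ⟨n, hn, hnk⟩ := frequently_atTop.1 ht.1 M
    have := (key n (hM.trans hn)).2 hnk
    rw [show trunc _ _ = _ from hMc n hn, show trunc _ _ = _ from hMc (n + 1) (by omega)] at this
    exact lt_irrefl _ this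

end Positional

theorem getElem?_concat_cases {α : Type*} {L : List α} {x x₁ : α} {j : ℕ}
    (h : (L ++ [x])[j]? = some x₁) : L[j]? = some x₁ ∨ (j = L.length ∧ x₁ = x) := by
  rw [List.getElem?_append] at h
  split_ifs at h with hj
  · exact .inl h
  · have : j - L.length = 0 := by
      by_contra hc
      rw [List.getElem?_eq_none (by simp; omega)] at h
      simp at h
    simp [this] at h
    exact .inr ⟨by omega, h.symm⟩

/-- Update of an enumeration `L` of ordinals to an enumeration of a new finite set `Y`: each old
slot moves to the greatest element of `Y` below it, colliding or empty slots die, and later slots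
shift towards the front; `e` is the first dead slot. -/
theorem exists_initial_slots (L : List Ordinal.{0}) (Y : Set Ordinal.{0}) :
    ∃ (L' : List Ordinal.{0}) (e : ℕ), L'.Nodup ∧ (∀ y ∈ L', y ∈ Y) ∧ e ≤ L'.length ∧
      (e = L.length ∧ L'.length = L.length ∨ e < L.length ∧ L'.length < L.length) ∧
      (∀ j < e, ∀ x y, L[j]? = some x → L'[j]? = some y → y ≤ x) ∧
      ∀ j x y, L[j]? = some x → IsGreatest {z | z ∈ Y ∧ z ≤ x} y →
        ∃ j' ≤ j, L'[j']? = some y ∧ (e ≤ j → j' < j) := by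
  induction L using List.reverseRecOn with
  | nil => exact ⟨[], 0, by simp⟩
  | append_singleton L x ih =>
    obtain ⟨L', e, hnd, hY, he, hlen, hle, hfl⟩ := ih
    by_cases hx : ∃ y, y ∉ L' ∧ IsGreatest {z | z ∈ Y ∧ z ≤ x} y
    · obtain ⟨y, hy, hyx⟩ := hx
      have hold : ∀ j x₁ y₁, L[j]? = some x₁ → IsGreatest {z | z ∈ Y ∧ z ≤ x₁} y₁ →
          ∃ j' ≤ j, (L' ++ [y])[j']? = some y₁ ∧ (e ≤ j → j' < j) := by
        intro j x₁ y₁ h1 h2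
        obtain ⟨j', hj', h3, h4⟩ := hfl j x₁ y₁ h1 h2
        exact ⟨j', hj', by
          rw [List.getElem?_append_left (List.getElem?_eq_some_iff.1 h3).1, h3], h4⟩
      have hnd' : (L' ++ [y]).Nodup := by
        rw [List.nodup_append]; simp [hnd]; rintro a ha rfl; exact hy ha
      have hY' : ∀ z ∈ L' ++ [y], z ∈ Y := by
        intro z hz
        rcases List.mem_append.1 hz with hz | hz
        · exact hY z hz
        · rw [List.mem_singleton.1 hz]; exact hyx.1.1
      rcases hlen with ⟨h1, h2⟩ | ⟨h1, h2⟩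
      · refine ⟨L' ++ [y], L.length + 1, hnd', hY', by simp [h2], .inl (by simp [h2]), ?_, ?_⟩
        · intro j hj x₁ y₁ hx₁ hy₁
          rcases getElem?_concat_cases hx₁ with h | ⟨rfl, rfl⟩
          · have hj' := (List.getElem?_eq_some_iff.1 h).1
            refine hle j (by omega) x₁ y₁ h ?_
            rwa [List.getElem?_append_left (by omega)] at hy₁
          · rw [← h2] at hy₁
            simp at hy₁
            exact hy₁ ▸ hyx.1.2
        · intro j x₁ y₁ hx₁ hy₁
          rcases getElem?_concat_cases hx₁ with h | ⟨rfl, rfl⟩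
          · have hj' := (List.getElem?_eq_some_iff.1 h).1
            obtain ⟨j', h3, h4, _⟩ := hold j x₁ y₁ h hy₁
            exact ⟨j', h3, h4, by omega⟩
          · refine ⟨L.length, le_rfl, ?_, by omega⟩
            rw [hy₁.unique hyx, ← h2]
            simp
      · refine ⟨L' ++ [y], e, hnd', hY', by simp; omega, .inr (by simp; omega), ?_, ?_⟩
        · intro j hj x₁ y₁ hx₁ hy₁
          rcases getElem?_concat_cases hx₁ with h | ⟨rfl, rfl⟩
          · refine hle j hj x₁ y₁ h ?_
            rwa [List.getElem?_append_left (by omega)] at hy₁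
          · omega
        · intro j x₁ y₁ hx₁ hy₁
          rcases getElem?_concat_cases hx₁ with h | ⟨rfl, rfl⟩
          · exact hold j x₁ y₁ h hy₁
          · refine ⟨L'.length, h2.le, ?_, fun _ => h2⟩
            rw [hy₁.unique hyx]
            simp
    · refine ⟨L', e, hnd, hY, he, .inr (by simp; omega), ?_, ?_⟩
      · intro j hj x₁ y₁ hx₁ hy₁
        rcases getElem?_concat_cases hx₁ with h | ⟨rfl, rfl⟩
        · exact hle j hj x₁ y₁ h hy₁
        · omega
      · intro j x₁ y₁ hx₁ hy₁
        rcases getElem?_concat_cases hx₁ with h | ⟨rfl, rfl⟩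
        · exact hfl j x₁ y₁ h hy₁
        · have : y₁ ∈ L' := by
            by_contra hc
            exact hx ⟨y₁, hc, hy₁⟩
          obtain ⟨j', hj', h⟩ := List.getElem_of_mem this
          refine ⟨j', by omega, by rw [← h, List.getElem?_eq_getElem hj'], by omega⟩

theorem exists_slot_update (L : List Ordinal.{0}) (Y : Set Ordinal.{0}) (hY : Y.Finite) :
    ∃ (L' : List Ordinal.{0}) (e : ℕ), L'.Nodup ∧ (∀ y, y ∈ L' ↔ y ∈ Y) ∧ e ≤ L'.length ∧
      e ≤ L.length ∧ (∀ j < e, ∀ x y, L[j]? = some x → L'[j]? = some y → y ≤ x) ∧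
      ∀ j x y, L[j]? = some x → IsGreatest {z | z ∈ Y ∧ z ≤ x} y →
        ∃ j' ≤ j, L'[j']? = some y ∧ (e ≤ j → j' < j) := by
  classical
  obtain ⟨L', e, hnd, hsub, he, hlen, hle, hfl⟩ := exists_initial_slots L Y
  refine ⟨L' ++ (hY.toFinset.filter (· ∉ L')).toList, e, ?_, ?_, by simp; omega, by omega, ?_, ?_⟩
  · rw [List.nodup_append]
    refine ⟨hnd, Finset.nodup_toList _, ?_⟩
    rintro a ha _ hb rfl
    simp at hb
    exact hb.2 ha
  · intro y
    by_cases hy : y ∈ L'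
    · simp [hy, hsub]
    · simp [hy]
  · intro j hj x y hx hy
    rw [List.getElem?_append_left (by omega)] at hy
    exact hle j hj x y hx hy
  · intro j x y hx hy
    obtain ⟨j', h1, h2, h3⟩ := hfl j x y hx hy
    exact ⟨j', h1, by
      rw [List.getElem?_append_left (List.getElem?_eq_some_iff.1 h2).1, h2], h3⟩

section Regularize

variable {B X Q : Type}

/-- A node of the unravelling with its live traces and an enumeration of their ranks. -/
structure LiveState (G : List B → Q → Prop) (ρ : List B → Q → Ordinal.{0}) where
  word : List B
  live : Set Q
  slots : List Ordinal.{0}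
  good : ∀ q ∈ live, G word q
  nodup : slots.Nodup
  mem : ∀ y, y ∈ slots ↔ ∃ q ∈ live, ρ word q = y

variable {G : List B → Q → Prop} {ρ : List B → Q → Ordinal.{0}}

namespace LiveState

/-- The finite information kept about a live state. -/
def cls (ℓ : List B → X) (Z : LiveState G ρ) :
    X × Set (Q × Fin (Nat.card Q)) × Set (Fin (Nat.card Q) × Fin (Nat.card Q)) :=
  (ℓ Z.word, {p | p.1 ∈ Z.live ∧ Z.slots[p.2.1]? = some (ρ Z.word p.1)},
    {p | ∃ x y, Z.slots[p.1.1]? = some x ∧ Z.slots[p.2.1]? = some y ∧ x ≤ y})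

/-- The enumeration of ranks as a vector, padded by `0`. -/
def vec (Z : LiveState G ρ) : Fin (Nat.card Q) → Ordinal.{0} := fun i => Z.slots[i.1]?.getD 0

theorem length_le [Finite Q] (Z : LiveState G ρ) : Z.slots.length ≤ Nat.card Q := by
  classical
  have h1 : (Z.slots.toFinset : Set Ordinal.{0}) = ρ Z.word '' Z.live := by
    ext y
    simp [Z.mem]
  rw [← List.toFinset_card_of_nodup Z.nodup, ← Set.ncard_coe_finset, h1]
  exact (Set.ncard_image_le (Set.toFinite _)).trans (Set.ncard_le_card _)

theorem lt_card [Finite Q] {Z : LiveState G ρ} {j : ℕ} {x : Ordinal.{0}}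
    (h : Z.slots[j]? = some x) : j < Nat.card Q :=
  (List.getElem?_eq_some_iff.1 h).1.trans_le Z.length_le

theorem vec_eq {Z : LiveState G ρ} {j : Fin (Nat.card Q)} {x : Ordinal.{0}}
    (h : Z.slots[j.1]? = some x) : Z.vec j = x := by simp [vec, h]

theorem exists_slot (Z : LiveState G ρ) {q : Q} (hq : q ∈ Z.live) :
    ∃ j : ℕ, Z.slots[j]? = some (ρ Z.word q) :=
  List.getElem?_of_mem ((Z.mem _).2 ⟨q, hq, rfl⟩)

variable [Finite Q] {ℓ : List B → X} {Z Z' : LiveState G ρ}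

theorem cls_slot (h : Z.cls ℓ = Z'.cls ℓ) {q : Q} {j : ℕ} (hq : q ∈ Z.live)
    (hj : Z.slots[j]? = some (ρ Z.word q)) :
    q ∈ Z'.live ∧ Z'.slots[j]? = some (ρ Z'.word q) := by
  have := congrArg (fun c => (q, (⟨j, lt_card hj⟩ : Fin (Nat.card Q))) ∈ c.2.1) h
  exact this.mp ⟨hq, hj⟩

theorem cls_live (h : Z.cls ℓ = Z'.cls ℓ) {q : Q} (hq : q ∈ Z.live) : q ∈ Z'.live :=
  (cls_slot h hq (Z.exists_slot hq).choose_spec).1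

theorem cls_le (h : Z.cls ℓ = Z'.cls ℓ) {i j : ℕ} {x y x' y' : Ordinal.{0}}
    (hx : Z.slots[i]? = some x) (hy : Z.slots[j]? = some y) (hx' : Z'.slots[i]? = some x')
    (hy' : Z'.slots[j]? = some y') (hxy : x ≤ y) : x' ≤ y' := by
  have := congrArg (fun c => ((⟨i, lt_card hx⟩, ⟨j, lt_card hy⟩) :
    Fin (Nat.card Q) × Fin (Nat.card Q)) ∈ c.2.2) h
  obtain ⟨a, b, ha, hb, hab⟩ := this.mp ⟨x, y, hx, hy, hxy⟩
  simp only at ha hb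
  rw [hx', Option.some_inj] at ha
  rw [hy', Option.some_inj] at hb
  rwa [ha, hb]

theorem cls_getElem (h : Z.cls ℓ = Z'.cls ℓ) {i : ℕ} {x : Ordinal.{0}}
    (hx : Z.slots[i]? = some x) : ∃ x', Z'.slots[i]? = some x' := by
  have := congrArg (fun c => ((⟨i, lt_card hx⟩, ⟨i, lt_card hx⟩) :
    Fin (Nat.card Q) × Fin (Nat.card Q)) ∈ c.2.2) h
  obtain ⟨a, b, ha, hb, hab⟩ := this.mp ⟨x, x, hx, hx, le_rfl⟩
  exact ⟨a, ha⟩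

end LiveState

variable [Finite Q]

/-- Data of one update of a live state by a letter. -/
structure Upd (Tr : X → B → Q → Bool → Q → Prop) (ℓ : List B → X) (Z : LiveState G ρ) (b : B)
    (Z' : LiveState G ρ) (e : ℕ) : Prop where
  word : Z'.word = b :: Z.word
  live : Z'.live = {q' | ∃ q ∈ Z.live, ∃ f, Tr (ℓ Z.word) b q f q'}
  le_new : e ≤ Z'.slots.length
  le_old : e ≤ Z.slots.length
  le : ∀ j < e, ∀ x y, Z.slots[j]? = some x → Z'.slots[j]? = some y → y ≤ x
  floor : ∀ j x y, Z.slots[j]? = some x → IsGreatest {z | z ∈ Z'.slots ∧ z ≤ x} y →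
    ∃ j' ≤ j, Z'.slots[j']? = some y ∧ (e ≤ j → j' < j)

theorem exists_upd {Tr : X → B → Q → Bool → Q → Prop} {ℓ : List B → X}
    (hG : ∀ w b q f q', G w q → Tr (ℓ w) b q f q' → G (b :: w) q')
    (Z : LiveState G ρ) (b : B) : ∃ Z' e, Upd Tr ℓ Z b Z' e := by
  set live' : Set Q := {q' | ∃ q ∈ Z.live, ∃ f, Tr (ℓ Z.word) b q f q'} with hl
  obtain ⟨L', e, h1, h2, h3, h4, h5, h6⟩ := exists_slot_update Z.slots
    (ρ (b :: Z.word) '' live') (Set.toFinite _)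
  refine ⟨⟨b :: Z.word, live', L', ?_, h1, h2⟩, e, rfl, rfl, h3, h4, h5, ?_⟩
  · rintro q' ⟨q, hq, f, hf⟩
    exact hG _ _ _ _ _ (Z.good q hq) hf
  · simpa only [h2] using h6

/-- Along class jumps and updates, a trace drops in rank only finitely often. -/
theorem not_frequently_drop {Tr : X → B → Q → Bool → Q → Prop} {ℓ : List B → X}
    (hρ : ∀ w b q f q', G w q → Tr (ℓ w) b q f q' →
      ρ (b :: w) q' ≤ ρ w q ∧ (f = true → ρ (b :: w) q' < ρ w q))
    (R U : ℕ → LiveState G ρ) (β : ℕ → B) (e : ℕ → ℕ) (hU : ∀ n, Upd Tr ℓ (R n) (β n) (U n) (e n))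
    (hcls : ∀ n, (U n).cls ℓ = (R (n + 1)).cls ℓ)
    (hmin : ∀ n, toLex (R (n + 1)).vec ≤ toLex (U n).vec)
    (q : ℕ → Q) (f : ℕ → Bool) (h0 : q 0 ∈ (R 0).live)
    (hq : ∀ n, Tr (ℓ (R n).word) (β n) (q n) (f n) (q (n + 1))) :
    ¬ ∃ᶠ n in atTop, f n = true := by
  have hUlive : ∀ n, q n ∈ (R n).live → q (n + 1) ∈ (U n).live := fun n hn => by
    rw [(hU n).live]; exact ⟨q n, hn, f n, hq n⟩
  have hlive : ∀ n, q n ∈ (R n).live := by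
    intro n
    induction n with
    | zero => exact h0
    | succ n ih => exact LiveState.cls_live (hcls n) (hUlive n ih)
  replace hUlive := fun n => hUlive n (hlive n)
  set r : ℕ → Ordinal.{0} := fun n => ρ (R n).word (q n) with hr
  set r' : ℕ → Ordinal.{0} := fun n => ρ (U n).word (q (n + 1)) with hr'
  have hrr : ∀ n, r' n ≤ r n ∧ (f n = true → r' n < r n) := by
    intro n
    simp only [hr', (hU n).word]
    exact hρ _ _ _ _ _ ((R n).good _ (hlive n)) (hq n)
  -- the limit inferior of the first dead slots
  obtain ⟨E, T, hE, hfreq⟩ : ∃ E T, (∀ n ≥ T, E ≤ e n) ∧ ∃ᶠ n in atTop, e n = E := by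
    have hb : ∀ n, e n ≤ Nat.card Q := fun n => (hU n).le_old.trans (R n).length_le
    have hex : ∃ a, ¬ ∀ᶠ n in atTop, a ≤ e n := by
      refine ⟨Nat.card Q + 1, fun h => ?_⟩
      obtain ⟨n, hn⟩ := h.exists
      have := hb n
      omega
    classical
    have hs := Nat.find_spec hex
    have hm := fun a => Nat.find_min hex (m := a)
    generalize Nat.find hex = a at hs hm
    cases a with
    | zero => exact absurd (.of_forall fun n => Nat.zero_le _) hs
    | succ a =>
      have ha := not_not.1 (hm a (by omega))
      obtain ⟨T, hT⟩ := eventually_atTop.1 ha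
      refine ⟨a, T, hT, ?_⟩
      refine ((not_eventually.1 hs).and_eventually ha).mono fun n hn => ?_
      omega
  have hlenR : ∀ n ≥ T, E ≤ (R n).slots.length := fun n hn => (hE n hn).trans (hU n).le_old
  have hlenU : ∀ n ≥ T, E ≤ (U n).slots.length := fun n hn => (hE n hn).trans (hU n).le_new
  have hUR : ∀ n ≥ T, trunc E (U n).vec ≤ trunc E (R n).vec := by
    intro n hn
    refine trunc_le fun i hi => ?_
    have h1 := List.getElem?_eq_getElem (hi.trans_le (hlenR n hn))
    have h2 := List.getElem?_eq_getElem (hi.trans_le (hlenU n hn))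
    rw [LiveState.vec_eq h1, LiveState.vec_eq h2]
    exact (hU n).le i (hi.trans_le (hE n hn)) _ _ h1 h2
  obtain ⟨T₁, hT₁, hconst⟩ := eventually_const_of_antitone (fun n => trunc E (R n).vec) T
    fun n hn => (trunc_mono E (hmin n)).trans (hUR n hn)
  set C : ℕ → Ordinal.{0} := fun i => (R T₁).slots[i]?.getD 0 with hC
  have hEN : E ≤ Nat.card Q := (hlenR T le_rfl).trans (R T).length_le
  have hCR : ∀ n ≥ T₁, ∀ i < E, (R n).slots[i]? = some (C i) := by
    intro n hn i hi
    have h1 := List.getElem?_eq_getElem (hi.trans_le (hlenR n (by omega)))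
    have := trunc_eq_iff (hconst n hn) ⟨i, hi.trans_le hEN⟩ hi
    rw [LiveState.vec_eq h1] at this
    rw [h1, this]
    rfl
  have hCU : ∀ n ≥ T₁, ∀ i < E, (U n).slots[i]? = some (C i) := by
    intro n hn i hi
    have h1 := List.getElem?_eq_getElem (hi.trans_le (hlenU n (by omega)))
    have h2 : trunc E (U n).vec = trunc E (R T₁).vec :=
      ((hUR n (by omega)).trans (hconst n hn).le).antisymm
        ((hconst (n + 1) (by omega)).ge.trans (trunc_mono E (hmin n)))
    have := trunc_eq_iff h2 ⟨i, hi.trans_le hEN⟩ hi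
    rw [LiveState.vec_eq h1] at this
    rw [h1, this]
    rfl
  have hslot : ∀ n, ∃ j : ℕ, (U n).slots[j]? = some (r' n) ∧ (R (n + 1)).slots[j]? = some (r (n + 1)) := by
    intro n
    obtain ⟨j, hj⟩ := (U n).exists_slot (hUlive n)
    exact ⟨j, hj, (LiveState.cls_slot (hcls n) (hUlive n) hj).2⟩
  have hCle : ∀ n ≥ T₁, ∀ i < E, (C i ≤ r' n ↔ C i ≤ r (n + 1)) ∧ (r' n ≤ C i ↔ r (n + 1) ≤ C i) := by
    intro n hn i hi
    obtain ⟨j, hj, hj'⟩ := hslot n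
    have h1 := hCU n hn i hi
    have h2 := hCR (n + 1) (by omega) i hi
    exact ⟨⟨LiveState.cls_le (hcls n) h1 hj h2 hj', LiveState.cls_le (hcls n).symm h2 hj' h1 hj⟩,
      ⟨LiveState.cls_le (hcls n) hj h1 hj' h2, LiveState.cls_le (hcls n).symm hj' h2 hj h1⟩⟩
  -- the position of the trace among the stable slots stabilizes
  obtain ⟨T₂, hT₂, hpos⟩ := eventually_const_of_antitone
    (fun n => (({i | C i < r n}, {i | C i ≤ r n}) : Set (Fin E) × Set (Fin E))) T₁ (by
      intro n hn
      refine ⟨fun i hi => ?_, fun i hi => ?_⟩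
      · have hi' : C i < r (n + 1) := hi
        have := (hCle n hn i i.2).2
        have h3 : C i < r' n := by
          rw [← not_le] at hi' ⊢; rwa [this]
        exact h3.trans_le (hrr n).1
      · exact ((hCle n hn i i.2).1.2 hi).trans (hrr n).1)
  have hlt : ∀ n ≥ T₂, ∀ i < E, (C i < r n ↔ C i < r T₂) := fun n hn i hi =>
    Set.ext_iff.1 (congrArg Prod.fst (hpos n hn)) ⟨i, hi⟩
  have hle : ∀ n ≥ T₂, ∀ i < E, (C i ≤ r n ↔ C i ≤ r T₂) := fun n hn i hi =>
    Set.ext_iff.1 (congrArg Prod.snd (hpos n hn)) ⟨i, hi⟩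
  have hlt' : ∀ n ≥ T₂, ∀ i < E, (r' n ≤ C i ↔ r T₂ ≤ C i) := fun n hn i hi => by
    rw [(hCle n (by omega) i hi).2, ← not_lt, ← not_lt, hlt (n + 1) (by omega) i hi]
  have hle' : ∀ n ≥ T₂, ∀ i < E, (C i ≤ r' n ↔ C i ≤ r T₂) := fun n hn i hi => by
    rw [(hCle n (by omega) i hi).1, hle (n + 1) (by omega) i hi]
  have hge : ∀ n ≥ T₂, ∀ i < E, (r n ≤ C i ↔ r T₂ ≤ C i) := fun n hn i hi => by
    rw [← not_lt, ← not_lt, hlt n hn i hi]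
  by_cases hcase : ∃ i < E, C i = r T₂
  · obtain ⟨i, hi, hir⟩ := hcase
    intro hf
    obtain ⟨n, hn, hfn⟩ := frequently_atTop.1 hf T₂
    have h1 : r n ≤ C i := (hge n hn i hi).2 hir.ge
    have h2 : C i ≤ r' n := (hle' n hn i hi).2 hir.le
    exact absurd ((hrr n).2 hfn) (not_lt.2 (h1.trans h2))
  · push Not at hcase
    exfalso
    have hne : ∀ n ≥ T₂, ∀ i < E, C i ≠ r n := fun n hn i hi h =>
      hcase i hi (le_antisymm ((hle n hn i hi).1 h.le) ((hge n hn i hi).1 h.ge))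
    let Cap : ℕ → ℕ → Prop := fun n j => ∃ y, (R n).slots[j]? = some y ∧ r n ≤ y ∧
      ∀ i < E, r n ≤ C i → y < C i
    have hex : ∀ n ≥ T₂, ∃ j, Cap n j := by
      intro n hn
      obtain ⟨j, hj⟩ := (R n).exists_slot (hlive n)
      exact ⟨j, r n, hj, le_rfl, fun i hi h => h.lt_of_ne (hne n hn i hi).symm⟩
    have hcapE : ∀ n ≥ T₂, ∀ j, Cap n j → E ≤ j := by
      rintro n hn j ⟨y, h1, h2, h3⟩
      by_contra hj
      rw [not_le] at hj
      rw [hCR n (by omega) j hj, Option.some_inj] at h1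
      exact lt_irrefl _ (h3 j hj (h1 ▸ h2) |>.trans_eq h1)
    have hdesc : ∀ n ≥ T₂, ∀ j, Cap n j → ∃ j' ≤ j, Cap (n + 1) j' ∧ (e n ≤ j → j' < j) := by
      rintro n hn j ⟨y, h1, h2, h3⟩
      have hr'mem : r' n ∈ {z | z ∈ (U n).slots ∧ z ≤ y} :=
        ⟨((U n).mem _).2 ⟨_, hUlive n, rfl⟩, (hrr n).1.trans h2⟩
      have hfin : {z | z ∈ (U n).slots ∧ z ≤ y}.Finite :=
        (List.finite_toSet (U n).slots).subset fun z hz => hz.1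
      obtain ⟨y', hy'⟩ : ∃ y', IsGreatest {z | z ∈ (U n).slots ∧ z ≤ y} y' := by
        obtain ⟨y', h4, h5⟩ := Set.exists_max_image _ id hfin ⟨_, hr'mem⟩
        exact ⟨y', h4, h5⟩
      obtain ⟨j', h4, h5, h6⟩ := (hU n).floor j y y' h1 hy'
      refine ⟨j', h4, ?_, h6⟩
      obtain ⟨y'', hy''⟩ := LiveState.cls_getElem (hcls n) h5
      obtain ⟨j₁, hj₁, hj₁'⟩ := hslot n
      refine ⟨y'', hy'', LiveState.cls_le (hcls n) hj₁ h5 hj₁' hy'' (hy'.2 hr'mem),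
        fun i hi h => ?_⟩
      have h7 : y' < C i := hy'.1.2.trans_lt (h3 i hi (by
        rw [hge n hn i hi, ← hge (n + 1) (by omega) i hi]; exact h))
      rw [← not_le] at h7 ⊢
      exact fun h8 => h7 (LiveState.cls_le (hcls n).symm (hCR (n + 1) (by omega) i hi) hy''
        (hCU n (by omega) i hi) h5 h8)
    classical
    let p : ℕ → ℕ := fun n => if h : ∃ j, Cap n j then Nat.find h else 0
    have hp : ∀ n ≥ T₂, Cap n (p n) ∧ ∀ j, Cap n j → p n ≤ j := by
      intro n hn
      simp only [p, dif_pos (hex n hn)]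
      exact ⟨Nat.find_spec _, fun j hj => Nat.find_min' _ hj⟩
    obtain ⟨T₃, hT₃, hp3⟩ := eventually_const_of_antitone p T₂ fun n hn => by
      obtain ⟨j', h1, h2, -⟩ := hdesc n hn _ (hp n hn).1
      exact ((hp (n + 1) (by omega)).2 _ h2).trans h1
    obtain ⟨n, hn, hen⟩ := frequently_atTop.1 hfreq T₃
    obtain ⟨j', h1, h2, h3⟩ := hdesc n (by omega) _ (hp n (by omega)).1
    have h4 := h3 (hen.le.trans (hcapE n (by omega) _ (hp n (by omega)).1))
    have h5 := (hp (n + 1) (by omega)).2 _ h2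
    have h6 := hp3 n hn
    have h7 := hp3 (n + 1) (by omega)
    omega

/-- Memory for traces: a labelling of words all of whose traces have ranks can be replaced by a
finite automaton whose output is locally consistent with the labelling, and in which every trace
drops only finitely often. -/
theorem regularize [Finite X] (Tr : X → B → Q → Bool → Q → Prop) (ℓ : List B → X)
    (G : List B → Q → Prop) (ρ : List B → Q → Ordinal.{0})
    (hG : ∀ w b q f q', G w q → Tr (ℓ w) b q f q' →
      G (b :: w) q' ∧ ρ (b :: w) q' ≤ ρ w q ∧ (f = true → ρ (b :: w) q' < ρ w q))
    (q₀ : Q) (h₀ : G [] q₀) :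
    ∃ (M : Type) (_ : Finite M) (m₀ : M) (δ : M → B → M) (out : M → X),
      (∀ m b, ∃ w, out m = ℓ w ∧ out (δ m b) = ℓ (b :: w)) ∧
      ∀ (m : ℕ → M) (β : ℕ → B) (q : ℕ → Q) (f : ℕ → Bool), m 0 = m₀ →
        (∀ n, m (n + 1) = δ (m n) (β n)) → q 0 = q₀ →
        (∀ n, Tr (out (m n)) (β n) (q n) (f n) (q (n + 1))) → ¬ ∃ᶠ n in atTop, f n = true := by
  let Z₀ : LiveState G ρ := ⟨[], {q₀}, [ρ [] q₀], by simpa using h₀, by simp, by simp [eq_comm]⟩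
  let M := {c // ∃ Z : LiveState G ρ, Z.cls ℓ = c}
  have hrep : ∀ m : M, ∃ Z : LiveState G ρ, Z.cls ℓ = m.1 ∧
      ∀ Z' : LiveState G ρ, Z'.cls ℓ = m.1 → toLex Z.vec ≤ toLex Z'.vec := by
    intro m
    obtain ⟨Z, hZ, hm⟩ := (InvImage.wf (fun Z : LiveState G ρ => toLex Z.vec)
      (wellFounded_lt (α := Lex (Fin (Nat.card Q) → Ordinal.{0})))).has_min
      {Z | Z.cls ℓ = m.1} m.2
    exact ⟨Z, hZ, fun Z' h' => not_lt.1 (hm Z' h')⟩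
  choose rep hrep hmin using hrep
  have hupd := exists_upd (ρ := ρ) (Tr := Tr) (ℓ := ℓ) fun w b q f q' h h' => (hG w b q f q' h h').1
  choose upd e hupd using hupd
  refine ⟨M, inferInstance, ⟨_, Z₀, rfl⟩, fun m b => ⟨_, upd (rep m) b, rfl⟩, fun m => m.1.1, ?_, ?_⟩
  · refine fun m b => ⟨(rep m).word, ?_, ?_⟩
    · change m.1.1 = _
      rw [← hrep m]; rfl
    · rw [← (hupd (rep m) b).word]; rfl
  · intro m β q f hm0 hm hq0 hq
    have hcls : ∀ n, (upd (rep (m n)) (β n)).cls ℓ = (m (n + 1)).1 := fun n => by rw [hm]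
    refine not_frequently_drop (Tr := Tr) (ℓ := ℓ) (fun w b q f q' h h' => (hG w b q f q' h h').2)
      (fun n => rep (m n)) (fun n => upd (rep (m n)) (β n)) β _ (fun n => hupd _ _)
      (fun n => (hcls n).trans (hrep _).symm) (fun n => hmin _ _ (hcls n)) q f ?_ fun n => ?_
    · refine LiveState.cls_live (Z := Z₀) (ℓ := ℓ) ((hrep _).trans (by rw [hm0])).symm ?_
      simp [Z₀, hq0]
    · have : ℓ (rep (m n)).word = (m n).1.1 := by rw [← hrep (m n)]; rfl
      rw [this]
      exact hq n

end Regularize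

section Walk

variable {B Q I : Type} (down : Q → Option (B × Q)) (up : I → B → Q → Q → Prop) (col : Q → ℕ)

/-- One step of a walk on the tree of words labelled by `t`: in a state with a `down` instruction
extend the word by a letter, otherwise remove its first letter, as the label allows. -/
def WStep (t : List B → I) (z z' : List B × Q) : Prop :=
  (∃ b x, down z.2 = some (b, x) ∧ z' = (b :: z.1, x)) ∨
    (down z.2 = none ∧ ∃ b u y, z.1 = b :: u ∧ up (t z.1) b z.2 y ∧ z' = (u, y))

/-- There is a finite walk whose maximal color, not counting its end, is the given number. -/
inductive CPath (t : List B → I) : List B × Q → ℕ → List B × Q → Prop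
  | nil (z) : CPath t z 0 z
  | cons {z z' z'' : List B × Q} {m : ℕ} : WStep down up t z z' → CPath t z' m z'' →
      CPath t z (max (col z.2) m) z''

variable {down up col}

theorem CPath.trans {t : List B → I} {z z' z'' : List B × Q} {m m' : ℕ}
    (h : CPath down up col t z m z') (h' : CPath down up col t z' m' z'') :
    CPath down up col t z (max m m') z'' := by
  induction h with
  | nil => simpa using h'
  | cons hs _ ih => rw [max_assoc]; exact .cons hs (ih h')

theorem CPath.single {t : List B → I} {z z' : List B × Q} (h : WStep down up t z z') :
    CPath down up col t z (col z.2) z' := by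
  simpa using CPath.cons (col := col) h (.nil z')

theorem CPath.le {t : List B → I} {z z' : List B × Q} {m d : ℕ} (hd : ∀ x, col x ≤ d)
    (h : CPath down up col t z m z') : m ≤ d := by
  induction h with
  | nil => exact Nat.zero_le d
  | cons _ _ ih => exact max_le (hd _) ih

theorem CPath.rank {t : List B → I} {Gd : List B × Q → Prop} {ρ : ℕ → List B × Q → Ordinal.{0}}
    (hGd : ∀ z z', Gd z → WStep down up t z z' → Gd z' ∧ ∀ k, Even k → k ≠ 0 → col z.2 ≤ k →
      ρ k z' ≤ ρ k z ∧ (col z.2 = k → ρ k z' < ρ k z))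
    {z z' : List B × Q} {m : ℕ} (h : CPath down up col t z m z') (hz : Gd z) :
    Gd z' ∧ ∀ k, Even k → k ≠ 0 → m ≤ k → ρ k z' ≤ ρ k z ∧ (m = k → ρ k z' < ρ k z) := by
  induction h with
  | nil => exact ⟨hz, fun k _ hk _ => ⟨le_rfl, fun h => absurd h.symm hk⟩⟩
  | cons hs _ ih =>
    obtain ⟨h1, h2⟩ := hGd _ _ hz hs
    obtain ⟨h3, h4⟩ := ih h1
    refine ⟨h3, fun k hk hk0 hm => ?_⟩
    have h5 := h2 k hk hk0 ((le_max_left _ _).trans hm)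
    have h6 := h4 k hk hk0 ((le_max_right _ _).trans hm)
    refine ⟨h6.1.trans h5.1, fun h => ?_⟩
    rcases max_choice (col _) _ with hc | hc
    · exact h6.1.trans_lt (h5.2 (hc.symm.trans h))
    · exact (h6.2 (hc.symm.trans h)).trans_le h5.1

/-- The maximal color of `π` in the time interval `[a, b)`. -/
def maxCol (col : Q → ℕ) (π : ℕ → List B × Q) (a b : ℕ) : ℕ :=
  (Finset.Ico a b).sup fun s => col (π s).2

theorem maxCol_self (π : ℕ → List B × Q) (a : ℕ) : maxCol col π a a = 0 := by simp [maxCol]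

theorem maxCol_append (π : ℕ → List B × Q) {a b c : ℕ} (hab : a ≤ b) (hbc : b ≤ c) :
    maxCol col π a c = max (maxCol col π a b) (maxCol col π b c) := by
  rw [maxCol, ← Finset.Ico_union_Ico_eq_Ico hab hbc, Finset.sup_union]; rfl

theorem maxCol_succ (π : ℕ → List B × Q) (a : ℕ) :
    maxCol col π a (a + 1) = col (π a).2 := by simp [maxCol]

/-- The set `K u` is closed under the loops at `u` that stay above `u`. -/
structure LoopClosed (down : Q → Option (B × Q)) (up : I → B → Q → Q → Prop) (col : Q → ℕ)
    (t : List B → I) (K : List B → Q → ℕ → Q → Prop) : Prop where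
  refl : ∀ u x, K u x 0 x
  loop : ∀ u x b x' m y' z m' y, down x = some (b, x') → K (b :: u) x' m y' → down y' = none →
    up (t (b :: u)) b y' z → K u z m' y → K u x (max (col x) (max m (max (col y') m'))) y

theorem LoopClosed.mem {t : List B → I} {K : List B → Q → ℕ → Q → Prop}
    (hK : LoopClosed down up col t K) {π : ℕ → List B × Q}
    (hπ : ∀ n, WStep down up t (π n) (π (n + 1))) (T T' : ℕ) (hT : T ≤ T')
    (hge : ∀ s, T ≤ s → s ≤ T' → (π T).1.length ≤ (π s).1.length)
    (heq : (π T').1.length = (π T).1.length) :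
    (π T').1 = (π T).1 ∧ K (π T).1 (π T).2 (maxCol col π T T') (π T').2 := by
  induction hn : T' - T using Nat.strong_induction_on generalizing T T' with
  | _ n ih =>
  rcases hT.eq_or_lt with rfl | hlt
  · exact ⟨rfl, by rw [maxCol_self]; exact hK.refl _ _⟩
  rcases hπ T with ⟨b, x', hd, hz⟩ | ⟨-, b, u, y, hu, -, hz⟩
  swap
  · have := hge (T + 1) (by omega) (by omega)
    rw [hz, hu] at this
    simp at this
  have hex : ∃ s, T < s ∧ (π s).1.length = (π T).1.length := ⟨T', hlt, heq⟩
  classical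
  obtain ⟨hs1, hs2⟩ := Nat.find_spec hex
  have hsT' : Nat.find hex ≤ T' := Nat.find_min' hex ⟨hlt, heq⟩
  have hmin : ∀ r, T < r → r < Nat.find hex → (π r).1.length ≠ (π T).1.length :=
    fun r h1 h2 h3 => Nat.find_min hex h2 ⟨h1, h3⟩
  generalize Nat.find hex = s at hs1 hs2 hsT' hmin
  have hT1 : (π (T + 1)).1.length = (π T).1.length + 1 := by rw [hz]; simp
  obtain ⟨r, rfl⟩ : ∃ r, s = r + 1 := ⟨s - 1, by omega⟩
  have hTr : T + 1 ≤ r := by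
    by_contra hc
    have : r = T := by omega
    subst this
    omega
  have hge1 : ∀ q, T + 1 ≤ q → q ≤ r → (π (T + 1)).1.length ≤ (π q).1.length := by
    intro q h1 h2
    have h3 := hge q (by omega) (by omega)
    have h4 := hmin q (by omega) (by omega)
    omega
  have hr := hge1 r hTr le_rfl
  rcases hπ r with ⟨b', x'', -, hz'⟩ | ⟨hd', b', u, y, hu, hup, hz'⟩
  · rw [hz'] at hs2
    simp at hs2
    omega
  have hu' : (π r).1.length = u.length + 1 := by rw [hu]; simp
  have hs2' : u.length = (π T).1.length := by rw [← hs2, hz']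
  obtain ⟨h1, h2⟩ := ih (r - (T + 1)) (by omega) (T + 1) r hTr hge1 (by omega) rfl
  obtain ⟨h3, h4⟩ := ih (T' - (r + 1)) (by omega) (r + 1) T' (by omega)
    (fun q hq hq' => by rw [hs2]; exact hge q (by omega) hq') (by omega) rfl
  have hnode : b' :: u = b :: (π T).1 := by rw [← hu, h1, hz]
  obtain ⟨rfl, rfl⟩ := List.cons_eq_cons.1 hnode
  have hm : maxCol col π T T' = max (col (π T).2) (max (maxCol col π (T + 1) r)
      (max (col (π r).2) (maxCol col π (r + 1) T'))) := by
    rw [maxCol_append π (by omega : T ≤ T + 1) (by omega), maxCol_append π hTr (by omega),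
      maxCol_append π (by omega : r ≤ r + 1) (by omega), maxCol_succ, maxCol_succ]
  refine ⟨by rw [h3, hz'], ?_⟩
  rw [hm]
  refine hK.loop _ _ b' x' _ (π r).2 y _ _ hd ?_ hd' (hu ▸ hup) ?_
  · rw [hz] at h2; exact h2
  · rw [hz'] at h4; exact h4

/-- From `T` on, the walk never goes below its position at time `T`. -/
def IsFloor (π : ℕ → List B × Q) (T : ℕ) : Prop := ∀ s ≥ T, (π T).1.length ≤ (π s).1.length

/-- The level at time `T` is visited infinitely often. -/
def Recurs (π : ℕ → List B × Q) (T : ℕ) : Prop := ∀ a, ∃ s ≥ a, (π s).1.length = (π T).1.length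

theorem LoopClosed.next {t : List B → I} {K : List B → Q → ℕ → Q → Prop}
    (hK : LoopClosed down up col t K) {π : ℕ → List B × Q}
    (hπ : ∀ n, WStep down up t (π n) (π (n + 1))) (T : ℕ) (hT : IsFloor π T) :
    ∃ T' β, T < T' ∧ IsFloor π T' ∧
      ((β = none ∧ Recurs π T ∧ (π T').1 = (π T).1 ∧
          K (π T).1 (π T).2 (maxCol col π T T') (π T').2) ∨
        ∃ b, β = some b ∧ ¬ Recurs π T ∧ (π T').1 = b :: (π T).1 ∧ ∃ m y,
          K (π T).1 (π T).2 m y ∧ down y = some (b, (π T').2) ∧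
            maxCol col π T T' = max m (col y)) := by
  by_cases hrec : Recurs π T
  · obtain ⟨s, hs, hs'⟩ := hrec (T + 1)
    obtain ⟨h1, h2⟩ := hK.mem hπ T s (by omega) (fun r hr _ => hT r hr) hs'
    exact ⟨s, none, by omega, fun r hr => by rw [hs']; exact hT r (by omega),
      .inl ⟨rfl, hrec, h1, h2⟩⟩
  · have hex : ∃ a, ∀ s ≥ a, (π s).1.length ≠ (π T).1.length := by
      simpa [Recurs] using hrec
    classical
    have hspec := Nat.find_spec hex
    have hmin := fun a => Nat.find_min hex (m := a)
    have hTa : T < Nat.find hex := by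
      by_contra hc
      exact hspec T (by omega) rfl
    generalize Nat.find hex = a at hspec hmin hTa
    obtain ⟨s, rfl⟩ : ∃ s, a = s + 1 := ⟨a - 1, by omega⟩
    have hs : (π s).1.length = (π T).1.length := by
      by_contra hc
      refine hmin s (by omega) fun r hr => ?_
      rcases hr.lt_or_eq with h | h
      · exact hspec r h
      · rwa [← h]
    obtain ⟨h1, h2⟩ := hK.mem hπ T s (by omega) (fun r hr _ => hT r hr) hs
    have hlt : ∀ r ≥ s + 1, (π T).1.length + 1 ≤ (π r).1.length := by
      intro r hr
      have := hspec r hr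
      have := hT r (by omega)
      omega
    rcases hπ s with ⟨b, x', hd, hz⟩ | ⟨-, b, u, y, hu, -, hz⟩
    · refine ⟨s + 1, some b, by omega, fun r hr => ?_, .inr ⟨b, rfl, hrec, by rw [hz, h1], _, _, h2,
        by rw [hd, hz], ?_⟩⟩
      · rw [hz, h1]; exact hlt r hr
      · rw [maxCol_append π (by omega : T ≤ s) (by omega), maxCol_succ]
    · have h5 := hlt (s + 1) le_rfl
      rw [hz, ← hs, hu] at h5
      simp at h5

/-- The trace relation: follow a loop and then, for a proper letter, a `down` step; a trace may
guess an even color, and then drops whenever that color is the maximal one. -/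
def Trace (down : Q → Option (B × Q)) (col : Q → ℕ) (d : ℕ) (c : I × Set (Q × Fin (d + 1) × Q))
    (β : Option B) (p : Q × Option (Fin (d + 1))) (f : Bool)
    (p' : Q × Option (Fin (d + 1))) : Prop :=
  ∃ m : ℕ, (match β with
    | none => ∃ h : m < d + 1, (p.1, ⟨m, h⟩, p'.1) ∈ c.2
    | some b => ∃ (m₀ : Fin (d + 1)) (y : Q), (p.1, m₀, y) ∈ c.2 ∧ down y = some (b, p'.1) ∧
        m = max m₀.1 (col y)) ∧
    ((p.2 = none ∧ f = false) ∨ ∃ k : Fin (d + 1), p.2 = some k ∧ p'.2 = some k ∧ Even k.1 ∧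
      k.1 ≠ 0 ∧ m ≤ k ∧ (f = true → m = k))

/-- If walks along the labelling `t` have progress measures for the even colors, then there is a
labelling given by a finite automaton for which no walk has an even recurring maximal color. -/
theorem exists_automaton [Finite B] [Finite Q] [Finite I] {d : ℕ} (hd : ∀ x, col x ≤ d)
    (h0 : ∀ x, col x ≠ 0) (t : List B → I) (Gd : List B × Q → Prop)
    (ρ : ℕ → List B × Q → Ordinal.{0})
    (hGd : ∀ z z', Gd z → WStep down up t z z' → Gd z' ∧ ∀ k, Even k → k ≠ 0 → col z.2 ≤ k →
      ρ k z' ≤ ρ k z ∧ (col z.2 = k → ρ k z' < ρ k z))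
    (x₀ : Q) (hx₀ : Gd ([], x₀)) :
    ∃ (M : Type) (_ : Finite M) (m₀ : M) (δ : M → B → M) (out : M → I),
      Good (WStep down up fun u => out (u.foldr (fun b m => δ m b) m₀)) (fun z => col z.2)
        ([], x₀) := by
  let ℓ : List (Option B) → I × Set (Q × Fin (d + 1) × Q) := fun u =>
    (t u.reduceOption, {p | CPath down up col t (u.reduceOption, p.1) p.2.1 (u.reduceOption, p.2.2)})
  let ω : Ordinal.{0} := ⨆ p : ℕ × (List B × Q), ρ p.1 p.2
  let r : List (Option B) → Q × Option (Fin (d + 1)) → Ordinal.{0} := fun u p =>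
    match p.2 with
    | none => ω
    | some k => ρ k.1 (u.reduceOption, p.1)
  have hω : ∀ u p, r u p ≤ ω := by
    rintro u ⟨x, _ | k⟩
    · exact le_rfl
    · exact Ordinal.le_iSup (fun p : ℕ × (List B × Q) => ρ p.1 p.2) (k.1, (u.reduceOption, x))
  obtain ⟨M, hM, m₀, δ, out, hcons, hsound⟩ := regularize (Trace down col d) ℓ
    (fun u p => Gd (u.reduceOption, p.1)) r (by
      rintro w b ⟨x, g⟩ f ⟨y, g'⟩ hg ⟨m, h1, h2⟩
      have hpath : CPath down up col t (w.reduceOption, x) m ((b :: w).reduceOption, y) := by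
        cases b with
        | none =>
          obtain ⟨h, h1⟩ := h1
          rw [List.reduceOption_cons_of_none]
          exact h1
        | some b =>
          obtain ⟨m₁, y₁, h1, h3, rfl⟩ := h1
          rw [List.reduceOption_cons_of_some]
          exact CPath.trans h1 (.single (.inl ⟨b, y, h3, rfl⟩))
      obtain ⟨h3, h4⟩ := hpath.rank hGd hg
      refine ⟨h3, ?_⟩
      rcases h2 with ⟨rfl, rfl⟩ | ⟨k, rfl, rfl, hk, hk0, hmk, hf⟩
      · exact ⟨hω _ _, by simp⟩
      · exact (h4 k hk hk0 hmk).imp_right fun h5 h6 => h5 (hf h6)) (x₀, none) hx₀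
  refine ⟨M, hM, m₀, fun m b => δ m (some b), fun m => (out m).1, ?_⟩
  set run : List B → M := fun u => u.foldr (fun b m => δ m (some b)) m₀ with hrun
  intro π hπ0 hπ k hk ht
  change ∀ n, WStep down up (fun u => (out (run u)).1) (π n) (π (n + 1)) at hπ
  set K : List B → Q → ℕ → Q → Prop := fun u x m y =>
    ∃ h : m < d + 1, (x, (⟨m, h⟩ : Fin (d + 1)), y) ∈ (out (run u)).2 with hKdef
  have hout : ∀ m, ∃ w, out m = ℓ w := fun m => by
    rcases isEmpty_or_nonempty B with hB | ⟨⟨b⟩⟩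
    · obtain ⟨w, hw, -⟩ := hcons m none
      exact ⟨w, hw⟩
    · obtain ⟨w, hw, -⟩ := hcons m (some b)
      exact ⟨w, hw⟩
  have hstay : ∀ m, out (δ m none) = out m := fun m => by
    obtain ⟨w, h1, h2⟩ := hcons m none
    rw [h1, h2]
    simp [ℓ]
  have hK : LoopClosed down up col (fun u => (out (run u)).1) K := by
    refine ⟨fun u x => ⟨by omega, ?_⟩, ?_⟩
    · obtain ⟨w, hw⟩ := hout (run u)
      rw [hw]
      exact .nil _
    · rintro u x b x' m y' z m' y hx ⟨hm, h1⟩ hy' hup ⟨hm', h2⟩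
      obtain ⟨w, h3, h4⟩ := hcons (run u) (some b)
      change out (run (b :: u)) = _ at h4
      rw [h4] at h1 hup
      rw [h3] at h2
      simp only [ℓ, List.reduceOption_cons_of_some, Set.mem_ofPred_eq] at h1 h2 hup
      have hp := CPath.cons (col := col) (down := down) (up := up) (t := t)
        (z := (w.reduceOption, x)) (.inl ⟨b, x', hx, rfl⟩)
        (h1.trans (.cons (.inr ⟨hy', b, w.reduceOption, z, rfl, hup, rfl⟩) h2))
      refine ⟨Nat.lt_succ_of_le (hp.le hd), ?_⟩
      rw [h3]
      exact hp
  have hnext := hK.next hπ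
  choose! nx β hnx using hnext
  let T : ℕ → ℕ := fun n => nx^[n] 0
  have hTs : ∀ n, T (n + 1) = nx (T n) := fun n => Function.iterate_succ_apply' _ _ _
  have hfloor : ∀ n, IsFloor π (T n) := by
    intro n
    induction n with
    | zero => intro s _; change (π 0).1.length ≤ _; simp [hπ0]
    | succ n ih => rw [hTs]; exact (hnx _ ih).2.1
  have hTlt : StrictMono T := strictMono_nat_of_lt_succ fun n => by
    rw [hTs]; exact (hnx _ (hfloor n)).1
  have hblock := fun n => (hnx _ (hfloor n)).2.2
  simp only [← hTs] at hblock
  let m : ℕ → M := fun n => Nat.rec m₀ (fun n a => δ a (β (T n))) n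
  have hm : ∀ n, m (n + 1) = δ (m n) (β (T n)) := fun n => rfl
  have hinv : ∀ n, out (m n) = out (run (π (T n)).1) ∧
      (¬ Recurs π (T n) → m n = run (π (T n)).1) := by
    intro n
    induction n with
    | zero =>
      have : run (π (T 0)).1 = m₀ := by change run (π 0).1 = m₀; rw [hπ0]; rfl
      rw [this]
      exact ⟨rfl, fun _ => rfl⟩
    | succ n ih =>
      rw [hm]
      rcases hblock n with ⟨hb, hr, he, -⟩ | ⟨b, hb, hr, he, -⟩
      · rw [hb, hstay, he]
        refine ⟨ih.1, fun h => absurd (fun a => ?_) h⟩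
        rw [he]; exact hr a
      · rw [hb, he, ih.2 hr]
        exact ⟨rfl, fun _ => rfl⟩
  obtain ⟨N, hN⟩ := eventually_atTop.1 ht.2
  have hkd : k < d + 1 := by
    obtain ⟨n, hn⟩ := ht.1.exists
    have := hd (π n).2
    dsimp only at hn
    omega
  have hk0 : k ≠ 0 := by
    obtain ⟨n, hn⟩ := ht.1.exists
    exact hn ▸ h0 _
  classical
  let g : ℕ → Option (Fin (d + 1)) := fun n => if N ≤ T n then some ⟨k, hkd⟩ else none
  refine hsound m (fun n => β (T n)) (fun n => ((π (T n)).2, if n = 0 then none else g n))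
    (fun n => decide (n ≠ 0 ∧ N ≤ T n ∧ maxCol col π (T n) (T (n + 1)) = k)) rfl hm ?_ ?_ ?_
  · change ((π 0).2, none) = _
    rw [hπ0]
  · intro n
    refine ⟨maxCol col π (T n) (T (n + 1)), ?_, ?_⟩
    · dsimp only
      rw [(hinv n).1]
      rcases hblock n with ⟨hb, hr, he, h1⟩ | ⟨b, hb, hr, he, m₁, y, ⟨h1, h2⟩, h3, h4⟩
      · rw [hb]
        exact h1
      · rw [hb]
        exact ⟨⟨m₁, h1⟩, y, h2, h3, h4⟩
    · by_cases hn : n ≠ 0 ∧ N ≤ T n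
      · have hT1 : N ≤ T (n + 1) := hn.2.trans (hTlt n.lt_succ_self).le
        refine .inr ⟨⟨k, hkd⟩, by simp [g, hn], by simp [g, hT1], hk, hk0, ?_, by simp⟩
        refine Finset.sup_le fun s hs => hN s ?_
        rw [Finset.mem_Ico] at hs
        omega
      · refine .inl ⟨?_, ?_⟩
        · by_cases h : n = 0
          · simp [h]
          · simp only [g, h, if_false]
            rw [if_neg fun h' => hn ⟨h, h'⟩]
        · exact decide_eq_false fun h => hn ⟨h.1, h.2.1⟩
  · rw [frequently_atTop]
    intro a
    obtain ⟨s, hs, hsk⟩ := frequently_atTop.1 ht.1 (T (max (a + 1) N))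
    have hex : ∃ n, s < T n := ⟨s + 1, Nat.lt_of_succ_le (hTlt.le_apply)⟩
    have h1 := Nat.find_spec hex
    have h2 := fun n => Nat.find_min hex (m := n)
    generalize Nat.find hex = p at h1 h2
    have h3 : max (a + 1) N < p := hTlt.lt_iff_lt.1 (hs.trans_lt h1)
    obtain ⟨n, rfl⟩ : ∃ n, p = n + 1 := ⟨p - 1, by omega⟩
    have h4 := not_lt.1 (h2 n (by omega))
    have h5 : n ≤ T n := hTlt.le_apply
    refine ⟨n, by omega, decide_eq_true ⟨by omega, by omega, le_antisymm ?_ ?_⟩⟩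
    · refine Finset.sup_le fun r hr => hN r ?_
      rw [Finset.mem_Ico] at hr
      omega
    · rw [← hsk]
      exact Finset.le_sup (f := fun s => col (π s).2) (Finset.mem_Ico.2 ⟨h4, h1⟩)

end Walk

section Encoding

variable {A P : Type}

/-- A stack as a word with its top in front and the bottom symbol `none` at the end. -/
def enc (w : List A) : List (Option A) := (w.map some).reverse ++ [none]

/-- The stack encoded by a word. -/
def dec (u : List (Option A)) : List A := u.reduceOption.reverse

theorem dec_enc (w : List A) : dec (enc w) = w := by
  simp [dec, enc, ← List.map_reverse, List.reduceOption]

theorem enc_append (w v : List A) : enc (w ++ v) = (v.map some).reverse ++ enc w := by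
  simp [enc]

theorem enc_concat (w : List A) (a : A) : enc (w ++ [a]) = some a :: enc w := by
  simp [enc]

theorem enc_eq_cons (w : List A) : ∃ b u, enc w = b :: u := by
  rcases w.eq_nil_or_concat with rfl | ⟨w, a, rfl⟩
  · exact ⟨none, [], rfl⟩
  · exact ⟨some a, enc w, by rw [List.concat_eq_append, enc_concat]⟩

/-- The letters pushed by a rule, including the bottom symbol if the rule popped it. -/
def pushed (r : PDRule A P) : List (Option A) :=
  (match r.pop with | none => [none] | some _ => []) ++ r.push.map some

theorem exists_of_ruleStep {r : PDRule A P} {v v' : List A × P} (h : RuleStep r v v') :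
    ∃ u, enc v.1 = r.pop :: u ∧ enc v'.1 = (pushed r).reverse ++ u := by
  obtain ⟨-, -, ⟨w, a, h1, h2, h3⟩ | ⟨h1, h2, h3⟩⟩ := h
  · exact ⟨enc w, by rw [h2, enc_concat, h1], by simp [h3, enc_append, pushed, h1]⟩
  · exact ⟨[], by rw [h2, h1]; rfl, by simp [h3, enc, pushed, h1]⟩

theorem exists_ruleStep {r : PDRule A P} {v : List A × P} {u : List (Option A)}
    (hs : r.src = v.2) (hu : enc v.1 = r.pop :: u) :
    ∃ v', RuleStep r v v' ∧ enc v'.1 = (pushed r).reverse ++ u := by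
  suffices h : ∃ v', RuleStep r v v' by
    obtain ⟨v', h⟩ := h
    obtain ⟨u', h1, h2⟩ := exists_of_ruleStep h
    rw [hu, List.cons_eq_cons] at h1
    exact ⟨v', h, h1.2 ▸ h2⟩
  rcases v.1.eq_nil_or_concat with hv | ⟨w, a, hv⟩
  · rw [hv] at hu
    have : r.pop = none := by simp [enc] at hu; exact hu.1.symm
    exact ⟨(r.push, r.dst), hs, rfl, .inr ⟨this, hv, rfl⟩⟩
  · rw [hv, List.concat_eq_append, enc_concat] at hu
    exact ⟨(w ++ r.push, r.dst), hs, rfl,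
      .inl ⟨w, a, (List.cons_eq_cons.1 hu).1.symm, by simpa using hv, rfl⟩⟩

end Encoding

section Machine

variable {A P : Type} {pOwner : P → Player} {Δ : Finset (PDRule A P)} {N : ℕ}

/-- States of the walk simulating the pushdown game: a control state with letters still to be
pushed, or `none` after the application of an inapplicable rule. -/
abbrev WState (A P : Type) (N : ℕ) : Type := Option (P × {l : List (Option A) // l.length ≤ N})

/-- Push the next pending letter. -/
def wDown : WState A P N → Option (Option A × WState A P N)
  | none => some (none, none)
  | some (_, ⟨[], _⟩) => none
  | some (q, ⟨b :: l, h⟩) => some (b, some (q, ⟨l, by simp at h; omega⟩))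

variable (pOwner Δ) in
/-- Pop the letter `b` by a rule chosen by the instruction `i` or by Player II. -/
def wUp (i : {p : P // pOwner p = Player.one} → {r : PDRule A P // r ∈ Δ}) (b : Option A)
    (x y : WState A P N) : Prop :=
  ∃ p h, x = some (p, ⟨[], h⟩) ∧
    ((∃ r ∈ Δ, (∀ ho : pOwner p = .one, r = (i ⟨p, ho⟩).1) ∧ r.pop = b ∧ r.src = p ∧
        ∃ hl, y = some (r.dst, ⟨pushed r, hl⟩)) ∨
      (∃ ho : pOwner p = .one, ¬ ((i ⟨p, ho⟩).1.pop = b ∧ (i ⟨p, ho⟩).1.src = p)) ∧ y = none)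

/-- Colors of the walk, shifted by two: pending states get color `1`, the error state `2`. -/
def wCol (c : P → ℕ) : WState A P N → ℕ
  | none => 2
  | some (q, ⟨l, _⟩) => if l = [] then c q + 2 else 1

/-- The walk configuration of a vertex of the pushdown game. -/
def cfg (N : ℕ) (v : List A × P) : List (Option A) × WState A P N :=
  (enc v.1, some (v.2, ⟨[], Nat.zero_le N⟩))

variable {c : P → ℕ}
  {t : List (Option A) → ({p : P // pOwner p = Player.one} → {r : PDRule A P // r ∈ Δ})}

/-- The walk along instructions `t`. -/
abbrev PStep (N : ℕ)
    (t : List (Option A) → ({p : P // pOwner p = Player.one} → {r : PDRule A P // r ∈ Δ})) :=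
  WStep (wDown (A := A) (P := P) (N := N)) (wUp pOwner Δ) t

theorem pStep_push (u : List (Option A)) (q : P) (b : Option A) (l : List (Option A))
    (h : (b :: l).length ≤ N) (h' : l.length ≤ N) :
    PStep N t (u, some (q, ⟨b :: l, h⟩)) (b :: u, some (q, ⟨l, h'⟩)) :=
  .inl ⟨b, _, rfl, rfl⟩

theorem push_rank {k : ℕ} (hk : 1 ≤ k) {ρ : List (Option A) × WState A P N → Ordinal.{0}}
    (hρ : ∀ z z', Good (PStep N t) (fun z => wCol c z.2) z → PStep N t z z' → wCol c z.2 ≤ k →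
      ρ z' ≤ ρ z) (q : P) (l : List (Option A)) (h : l.length ≤ N) (u : List (Option A))
    (hg : Good (PStep N t) (fun z => wCol c z.2) (u, some (q, ⟨l, h⟩))) :
    Good (PStep N t) (fun z => wCol c z.2) (l.reverse ++ u, some (q, ⟨[], Nat.zero_le N⟩)) ∧
      ρ (l.reverse ++ u, some (q, ⟨[], Nat.zero_le N⟩)) ≤ ρ (u, some (q, ⟨l, h⟩)) := by
  induction l generalizing u with
  | nil => exact ⟨hg, le_rfl⟩
  | cons b l ih =>
    have h' : l.length ≤ N := by simp at h; omega
    have hs := pStep_push (t := t) u q b l h h'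
    have := ih h' (b :: u) (hg.step hs)
    simp only [List.reverse_cons, List.append_assoc, List.singleton_append]
    exact ⟨this.1, this.2.trans (hρ _ _ hg hs (by simpa [wCol] using hk))⟩

/-- A move of the pushdown game played according to `t` is simulated by the walk. -/
theorem rule_rank (hN : ∀ r ∈ Δ, (pushed r).length ≤ N) {k : ℕ}
    {ρ : List (Option A) × WState A P N → Ordinal.{0}}
    (hρ : ∀ z z', Good (PStep N t) (fun z => wCol c z.2) z → PStep N t z z' →
      wCol c z.2 ≤ k + 2 → ρ z' ≤ ρ z ∧ (wCol c z.2 = k + 2 → ρ z' < ρ z))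
    {v v' : List A × P} (hg : Good (PStep N t) (fun z => wCol c z.2) (cfg N v))
    {r : PDRule A P} (hr : r ∈ Δ) (hrt : ∀ ho : pOwner v.2 = .one, r = (t (enc v.1) ⟨v.2, ho⟩).1)
    (h : RuleStep r v v') :
    Good (PStep N t) (fun z => wCol c z.2) (cfg N v') ∧ (c v.2 ≤ k →
      ρ (cfg N v') ≤ ρ (cfg N v) ∧ (c v.2 = k → ρ (cfg N v') < ρ (cfg N v))) := by
  obtain ⟨u, h1, h2⟩ := exists_of_ruleStep h
  have hs : PStep N t (cfg N v) (u, some (r.dst, ⟨pushed r, hN r hr⟩)) :=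
    .inr ⟨rfl, r.pop, u, _, h1, ⟨v.2, _, rfl, .inl ⟨r, hr, hrt, rfl, h.1, _, rfl⟩⟩, rfl⟩
  have := push_rank (k := k + 2) (by omega) (fun z z' h1 h2 h3 => (hρ z z' h1 h2 h3).1) _ _ _ _
    (hg.step hs)
  rw [← h2, h.2.1] at this
  refine ⟨this.1, fun hc => ?_⟩
  have h3 := hρ _ _ hg hs (by simpa [wCol, cfg] using hc)
  rw [h.2.1] at h3
  exact ⟨this.2.trans h3.1, fun hk => this.2.trans_lt (h3.2 (by simpa [wCol, cfg] using hk))⟩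

theorem not_good_none (u : List (Option A)) :
    ¬ Good (PStep N t) (fun z => wCol c z.2) (u, none) := by
  intro h
  refine h (fun n => (List.replicate n none ++ u, none)) rfl (fun n => ?_) 2 even_two
    ⟨.of_forall fun n => rfl, .of_forall fun n => le_rfl⟩
  exact .inl ⟨none, none, rfl, by simp [List.replicate_succ]⟩

theorem applicable_of_good {v : List A × P}
    (hg : Good (PStep N t) (fun z => wCol c z.2) (cfg N v)) (ho : pOwner v.2 = .one) :
    ∃ v', RuleStep (t (enc v.1) ⟨v.2, ho⟩).1 v v' := by
  obtain ⟨b, u, hu⟩ := enc_eq_cons v.1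
  by_cases hr : (t (enc v.1) ⟨v.2, ho⟩).1.pop = b ∧ (t (enc v.1) ⟨v.2, ho⟩).1.src = v.2
  · obtain ⟨v', hv', -⟩ := exists_ruleStep hr.2 (hr.1 ▸ hu)
    exact ⟨v', hv'⟩
  · exact absurd (hg.step (.inr ⟨rfl, b, u, none, hu, ⟨v.2, _, rfl, .inr ⟨⟨ho, hr⟩, rfl⟩⟩, rfl⟩))
      (not_good_none u)

end Machine

section Positional

variable {A P : Type} {pOwner : P → Player} {Δ : Finset (PDRule A P)} {c : P → ℕ} {N : ℕ}

/-- The walk along a positional winning strategy admits progress measures. -/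
theorem exists_progress (r₀ : {r : PDRule A P // r ∈ Δ})
    {W : List A × P → Prop} {f : List A × P → List A × P}
    (hW : ∀ v w, W v → FStep (pushdownGame pOwner Δ c) f v w →
      W w ∧ (pushdownGame pOwner Δ c).E v w)
    (hg : ∀ v, W v → Good (FStep (pushdownGame pOwner Δ c) f) (pushdownGame pOwner Δ c).color v) :
    ∃ (t : List (Option A) → ({p : P // pOwner p = Player.one} → {r : PDRule A P // r ∈ Δ}))
      (Gd : List (Option A) × WState A P N → Prop)
      (ρ : ℕ → List (Option A) × WState A P N → Ordinal.{0}),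
      (∀ z z', Gd z → PStep N t z z' → Gd z' ∧ ∀ k, Even k → k ≠ 0 → wCol c z.2 ≤ k →
        ρ k z' ≤ ρ k z ∧ (wCol c z.2 = k → ρ k z' < ρ k z)) ∧
      ∀ w q l, W (w, q) → l.1.reverse = enc w → Gd ([], some (q, l)) := by
  have hρ : ∀ k, ∃ ρ : List A × P → Ordinal.{0}, Even k → ∀ z z', W z →
      FStep (pushdownGame pOwner Δ c) f z z' → c z.2 ≤ k →
        ρ z' ≤ ρ z ∧ (c z.2 = k → ρ z' < ρ z) := by
    intro k
    by_cases hk : Even k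
    · obtain ⟨ρ, hρ⟩ := exists_rank (FStep (pushdownGame pOwner Δ c) f) _ k hk
      exact ⟨ρ, fun _ z z' hz => hρ z z' (hg z hz)⟩
    · exact ⟨fun _ => 0, fun h => absurd h hk⟩
  choose ρ hρ using hρ
  have hR : ∀ (w : List A) (p : {p : P // pOwner p = Player.one}),
      ∃ r : {r : PDRule A P // r ∈ Δ}, W (w, p) → RuleStep r.1 (w, p) (f (w, p)) := by
    intro w p
    by_cases hv : W (w, p)
    · obtain ⟨r, hr, hs⟩ := (hW (w, p) _ hv (.inl ⟨p.2, rfl⟩)).2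
      exact ⟨⟨r, hr⟩, fun _ => hs⟩
    · exact ⟨r₀, fun h => absurd h hv⟩
  choose R hR using hR
  let t : List (Option A) → ({p : P // pOwner p = Player.one} → {r : PDRule A P // r ∈ Δ}) :=
    fun u => R (dec u)
  have ht : ∀ w q (ho : pOwner q = .one), W (w, q) →
      RuleStep (t (enc w) ⟨q, ho⟩).1 (w, q) (f (w, q)) := by
    intro w q ho hv
    simp only [t, dec_enc]
    exact hR w ⟨q, ho⟩ hv
  refine ⟨t, fun z => ∃ w q l, z.2 = some (q, l) ∧ l.1.reverse ++ z.1 = enc w ∧ W (w, q),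
    fun k z => match z.2 with
      | none => 0
      | some (q, l) => ρ (k - 2) (dec (l.1.reverse ++ z.1), q), ?_,
    fun w q l h1 h2 => ⟨w, q, l, rfl, by simpa using h2, h1⟩⟩
  rintro ⟨u, x⟩ z' ⟨w, q, ⟨l, hl⟩, hx, hu, hwq⟩ hs
  dsimp only at hx hu
  subst hx
  cases l with
  | cons b l =>
    rcases hs with ⟨b', x', hd, rfl⟩ | ⟨hd, -⟩
    · simp only [wDown, Option.some_inj, Prod.mk.injEq] at hd
      obtain ⟨rfl, rfl⟩ := hd
      have h1 : l.reverse ++ b :: u = (b :: l).reverse ++ u := by simp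
      refine ⟨⟨w, q, _, rfl, h1.trans hu, hwq⟩, fun k hk _ _ => ?_⟩
      dsimp only
      rw [h1]
      refine ⟨le_rfl, fun h => ?_⟩
      simp [wCol] at h
      rw [← h] at hk
      exact absurd hk (by decide)
    · simp [wDown] at hd
  | nil =>
    rcases hs with ⟨b', x', hd, -⟩ | ⟨-, b, u', y, rfl, hup, rfl⟩
    · simp [wDown] at hd
    simp only [List.reverse_nil, List.nil_append] at hu
    have key : ∃ r ∈ Δ, ∃ v', RuleStep r (w, q) v' ∧
        FStep (pushdownGame pOwner Δ c) f (w, q) v' ∧ r.pop = b ∧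
        ∃ hl, y = some (r.dst, ⟨pushed r, hl⟩) := by
      obtain ⟨p, h, he, hup⟩ := hup
      simp only [Option.some_inj, Prod.mk.injEq] at he
      obtain ⟨rfl, -⟩ := he
      dsimp only at hup
      rw [hu] at hup
      by_cases ho : pOwner q = .one
      · have h1 := ht w q ho hwq
        obtain ⟨u₁, h2, -⟩ := exists_of_ruleStep h1
        replace h2 := List.cons_eq_cons.1 (hu.trans h2)
        rcases hup with ⟨r, hr, hri, hb, -, hy⟩ | ⟨⟨_, h3⟩, -⟩
        · rw [← hri ho] at h1
          exact ⟨r, hr, _, h1, .inl ⟨ho, rfl⟩, hb, hy⟩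
        · exact absurd ⟨h2.1.symm, h1.1⟩ h3
      · rcases hup with ⟨r, hr, -, hb, hsrc, hy⟩ | ⟨⟨h3, -⟩, -⟩
        · obtain ⟨v', hv', -⟩ := exists_ruleStep (v := (w, q)) hsrc (hu.symm.trans (by rw [hb]))
          exact ⟨r, hr, v', hv', .inr ⟨ho, r, hr, hv'⟩, hb, hy⟩
        · exact absurd h3 ho
    obtain ⟨r, hr, v', hv', hF, rfl, hlen, rfl⟩ := key
    obtain ⟨u₁, h1, h2⟩ := exists_of_ruleStep hv'
    rw [← hu, List.cons_eq_cons] at h1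
    rw [← h1.2] at h2
    refine ⟨⟨v'.1, r.dst, _, rfl, h2.symm, ?_⟩, fun k hk hk0 hc => ?_⟩
    · rw [hv'.2.1]; exact (hW _ _ hwq hF).1
    · have h3 : c q + 2 ≤ k := by simpa [wCol] using hc
      have hk2 : Even (k - 2) := (Nat.even_sub (by omega)).2 (by simp [hk])
      have h4 := hρ (k - 2) hk2 _ _ hwq hF (by dsimp only; omega)
      dsimp only
      rw [← h2, dec_enc, hv'.2.1, List.reverse_nil, List.nil_append, hu, dec_enc]
      refine ⟨h4.1, fun h => h4.2 ?_⟩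
      have : c q + 2 = k := by simpa [wCol] using h
      dsimp only
      omega

end Positional

end PushdownParity

open PushdownParity Filter in
/-- If Player I has a winning strategy from `v₀` in a pushdown parity game, then some
regular instruction tree determines a memoryless winning strategy for Player I from `v₀`. -/
theorem statement6 {A P : Type} [Finite A] [Finite P]
    (pOwner : P → Player) (Δ : Finset (PDRule A P)) (c : P → ℕ)
    (htot : ∀ v, ∃ w, (pushdownGame pOwner Δ c).E v w)
    (v₀ : List A × P)
    (h : ∃ σ, WinningStrategyFrom (pushdownGame pOwner Δ c) Player.one σ v₀) :
    ∃ t : List A → ({p : P // pOwner p = Player.one} → {r : PDRule A P // r ∈ Δ}),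
      RegularFun t ∧
      ∃ f : List A × P → List A × P,
        MemorylessWinningFrom (pushdownGame pOwner Δ c) Player.one f v₀ ∧
        Determines pOwner Δ c Player.one t f v₀ := by
  obtain ⟨d, hd⟩ : ∃ d, ∀ p, c p ≤ d := by
    obtain ⟨d, hd⟩ := (Set.finite_range c).bddAbove
    exact ⟨d, fun p => hd ⟨p, rfl⟩⟩
  obtain ⟨N, hN, hN₀⟩ : ∃ N, (∀ r ∈ Δ, (pushed r).length ≤ N) ∧ (enc v₀.1).reverse.length ≤ N :=
    ⟨max (Δ.sup fun r => (pushed r).length) (enc v₀.1).reverse.length,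
      fun r hr => (Finset.le_sup (f := fun r => (pushed r).length) hr).trans (le_max_left _ _),
      le_max_right _ _⟩
  obtain ⟨r₀, hr₀, -⟩ := (htot v₀).choose_spec
  obtain ⟨σ, hσ⟩ := h
  obtain ⟨W, f, hW₀, hW, hWg⟩ := exists_positional (d := d) (fun v => hd v.2) hσ
  obtain ⟨t, Gd, ρ, hGd, hGd₀⟩ := exists_progress (N := N) ⟨r₀, hr₀⟩ hW hWg
  have : Finite {l : List (Option A) // l.length ≤ N} := List.finite_length_le _ _
  obtain ⟨M, _, m₀, δ, out, hgood⟩ := exists_automaton (d := d + 2) (col := wCol c)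
    (down := wDown (A := A) (P := P) (N := N)) (up := wUp pOwner Δ)
    (by
      rintro (_ | ⟨q, l, hl⟩)
      · simp [wCol]
      · have := hd q
        simp only [wCol]
        split_ifs <;> omega)
    (by
      rintro (_ | ⟨q, l, hl⟩)
      · simp [wCol]
      · simp only [wCol]
        split_ifs <;> omega)
    t Gd ρ hGd (some (v₀.2, ⟨(enc v₀.1).reverse, hN₀⟩)) (hGd₀ _ _ _ hW₀ (by simp))
  set T := fun u : List (Option A) => out (u.foldr (fun b m => δ m b) m₀) with hT
  have hgood₀ : Good (PStep N T) (fun z => wCol c z.2) (cfg N v₀) := by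
    have := (push_rank (c := c) (k := 1) le_rfl (ρ := fun _ => 0) (fun _ _ _ _ _ => le_rfl) _ _ _ _
      hgood).1
    simpa [cfg] using this
  classical
  let g : List A × P → List A × P := fun v =>
    if h : ∃ (ho : pOwner v.2 = .one) (v' : List A × P), RuleStep (T (enc v.1) ⟨v.2, ho⟩).1 v v'
      then h.choose_spec.choose else v
  have hg : ∀ v, Good (PStep N T) (fun z => wCol c z.2) (cfg N v) → ∀ ho : pOwner v.2 = .one,
      RuleStep (T (enc v.1) ⟨v.2, ho⟩).1 v (g v) := by
    intro v hv ho
    have h : ∃ (ho : pOwner v.2 = .one) (v' : List A × P),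
        RuleStep (T (enc v.1) ⟨v.2, ho⟩).1 v v' := ⟨ho, applicable_of_good hv ho⟩
    simp only [g, dif_pos h]
    exact h.choose_spec.choose_spec
  have hstep : ∀ v w, Good (PStep N T) (fun z => wCol c z.2) (cfg N v) →
      FStep (pushdownGame pOwner Δ c) g v w → ∃ r ∈ Δ,
        (∀ ho : pOwner v.2 = .one, r = (T (enc v.1) ⟨v.2, ho⟩).1) ∧ RuleStep r v w := by
    rintro v w hv (⟨ho, rfl⟩ | ⟨ho, r, hr, hs⟩)
    · exact ⟨_, (T (enc v.1) ⟨v.2, ho⟩).2, fun _ => rfl, hg v hv ho⟩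
    · exact ⟨r, hr, fun ho' => absurd ho' ho, hs⟩
  have hgstep : ∀ v w, Good (PStep N T) (fun z => wCol c z.2) (cfg N v) →
      FStep (pushdownGame pOwner Δ c) g v w →
        Good (PStep N T) (fun z => wCol c z.2) (cfg N w) := by
    intro v w hv hs
    obtain ⟨r, hr, hrt, hrs⟩ := hstep v w hv hs
    obtain ⟨ρ', hρ'⟩ := exists_rank (PStep N T) (fun z => wCol c z.2) (0 + 2) (by decide)
    exact (rule_rank hN hρ' hv hr hrt hrs).1
  have hreach : ∀ v, Reach (pushdownGame pOwner Δ c) .one g v₀ v →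
      Good (PStep N T) (fun z => wCol c z.2) (cfg N v) := by
    intro v hv
    induction hv with
    | base => exact hgood₀
    | ownStep _ ho ih => exact hgstep _ _ ih (.inl ⟨ho, rfl⟩)
    | oppStep _ ho hE ih => exact hgstep _ _ ih (.inr ⟨ho, hE⟩)
  have hlift : ∀ l v, l.getLast? = some v → liftMemoryless g v₀ l = g v := by
    intro l v hl
    simp [liftMemoryless, hl]
  have hcons : ∀ l, ConsHist (pushdownGame pOwner Δ c) .one (liftMemoryless g v₀) v₀ l →
      ∀ v, l.getLast? = some v → Good (PStep N T) (fun z => wCol c z.2) (cfg N v) := by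
    intro l hl
    induction hl with
    | init => rintro v ⟨⟩; exact hgood₀
    | ownStep l v _ hv ho ih =>
      intro w hw
      simp only [List.getLast?_append, List.getLast?_singleton, Option.some_or,
        Option.some_inj] at hw
      rw [← hw, hlift l v hv]
      exact hgstep _ _ (ih v hv) (.inl ⟨ho, rfl⟩)
    | oppStep l v w _ hv ho hE ih =>
      intro w' hw
      simp only [List.getLast?_append, List.getLast?_singleton, Option.some_or,
        Option.some_inj] at hw
      rw [← hw]
      exact hgstep _ _ (ih v hv) (.inr ⟨ho, hE⟩)
  refine ⟨fun w => T (enc w), ?_, g, ⟨fun l v hl hv ho => ?_, ?_⟩, fun v hv ho => ?_⟩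
  · let eM := Finite.equivFin M
    refine ⟨_, eM (δ m₀ none), fun i a => eM (δ (eM.symm i) (some a)), fun i => out (eM.symm i),
      fun w => ?_⟩
    simp only [hT]
    congr 1
    induction w using List.reverseRecOn with
    | nil => simp [enc]
    | append_singleton w a ih => simp [enc_concat, ih]
  · rw [hlift l v hv]
    exact ⟨_, (T (enc v.1) ⟨v.2, ho⟩).2, hg v (hcons l hl v hv) ho⟩
  · rintro π ⟨h0, hE⟩ hc hev
    have hs : ∀ n, FStep (pushdownGame pOwner Δ c) g (π n) (π (n + 1)) := by
      intro n
      by_cases ho : (pushdownGame pOwner Δ c).owner (π n) = .one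
      · exact .inl ⟨ho, by rw [hc n ho, hlift _ _ (hist_getLast? π n)]⟩
      · exact .inr ⟨ho, hE n⟩
    have hgπ : ∀ n, Good (PStep N T) (fun z => wCol c z.2) (cfg N (π n)) := by
      intro n
      induction n with
      | zero => rwa [h0]
      | succ n ih => exact hgstep _ _ ih (hs n)
    obtain ⟨k, hk, hfreq, hle⟩ := exists_top_of_maxInfEven (fun n => hd (π n).2) hev
    obtain ⟨ρ', hρ'⟩ := exists_rank (PStep N T) (fun z => wCol c z.2) (k + 2)
      (by simp [hk, parity_simps])
    have hdrop : ∀ n, c (π n).2 ≤ k → ρ' (cfg N (π (n + 1))) ≤ ρ' (cfg N (π n)) ∧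
        (c (π n).2 = k → ρ' (cfg N (π (n + 1))) < ρ' (cfg N (π n))) := by
      intro n
      obtain ⟨r, hr, hrt, hrs⟩ := hstep _ _ (hgπ n) (hs n)
      exact (rule_rank hN hρ' (hgπ n) hr hrt hrs).2
    obtain ⟨a, ha⟩ := eventually_atTop.1 hle
    obtain ⟨b, hb, hbc⟩ := eventually_const_of_antitone (fun n => ρ' (cfg N (π n))) a
      fun n hn => (hdrop n (ha n hn)).1
    obtain ⟨n, hn, hnk⟩ := frequently_atTop.1 hfreq b
    have h1 := (hdrop n (ha n (by omega))).2 hnk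
    rw [show ρ' _ = _ from hbc n hn, show ρ' _ = _ from hbc (n + 1) (by omega)] at h1
    exact lt_irrefl _ h1
  · exact hg v (hreach v hv) ho
end
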